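/- arXiv:2103.13330 — 3 statements merged into one kernel-verified Lean document; each statement's English description precedes it below -/
import Mathlib

section
/- For each d ≥ 1 there exists a constant C > 0 depending only on d such that for every integer l > 2 and every function u that is C² on a neighborhood of [0,1]^d, there exist real coefficients (c_i), indexed by multi-indices i = (i₁,…,i_d) ∈ ℤ^d with −3 < i_j < 2^l for each j, such that ‖ u − Σ_i c_i · N_{l,i} ‖_{H¹((0,1)^d)} ≤ (C/2^l)·‖u‖_{H²((0,1)^d)}. -/
open MeasureTheory

noncomputable section

/-- The open unit cube `(0,1)^d` in `ℝ^d`. -/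
def openCube (d : ℕ) : Set (EuclideanSpace ℝ (Fin d)) := {x | ∀ i, x i ∈ Set.Ioo (0:ℝ) 1}

/-- The closed unit cube `[0,1]^d` in `ℝ^d`. -/
def closedCube (d : ℕ) : Set (EuclideanSpace ℝ (Fin d)) := {x | ∀ i, x i ∈ Set.Icc (0:ℝ) 1}

/-- The squared `H¹((0,1)^d)` norm `∫ u² + ∫ ‖∇u‖²`. -/
def H1normSq (d : ℕ) (u : EuclideanSpace ℝ (Fin d) → ℝ) : ℝ :=
  (∫ x in openCube d, (u x)^2) + ∫ x in openCube d, ‖gradient u x‖^2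

/-- The squared `H²((0,1)^d)` norm: the squared `H¹` norm plus the integral of
the sum of squares of all second partial derivatives. -/
def H2normSq (d : ℕ) (u : EuclideanSpace ℝ (Fin d) → ℝ) : ℝ :=
  H1normSq d u + ∫ x in openCube d, ∑ i, ∑ j,
    (fderiv ℝ (fun y => fderiv ℝ u y (EuclideanSpace.single i 1)) x
      (EuclideanSpace.single j 1))^2

/-- The univariate cardinal B-spline of order `3` on the dyadic partition of
level `l`: `N_{l,i}(x) = 2^{2l−1}·Σ_{j=0}^{3} (−1)^j·(3 choose j)·(x − (i+j)·2^{−l})₊²`. -/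
def bspline (l : ℕ) (i : ℤ) (x : ℝ) : ℝ :=
  (2:ℝ) ^ (2 * (l:ℤ) - 1) *
    ∑ j ∈ Finset.range 4,
      (-1:ℝ)^j * (Nat.choose 3 j) * (max (x - ((i:ℝ) + (j:ℝ)) * (2:ℝ)^(-(l:ℤ))) 0)^2

/-- The multivariate cardinal B-spline of order `3`:
`N_{l,i}(x) = Π_{j=1}^d N_{l,i_j}(x_j)`. -/
def bsplineMulti (d : ℕ) (l : ℕ) (i : Fin d → ℤ) (x : EuclideanSpace ℝ (Fin d)) : ℝ :=
  ∏ j, bspline l (i j) (x j)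

/-- The sum of the squared first partial derivatives of `f` at `x`. -/
def gradSq (d : ℕ) (f : EuclideanSpace ℝ (Fin d) → ℝ) (x : EuclideanSpace ℝ (Fin d)) : ℝ :=
  ∑ j, (fderiv ℝ f x (EuclideanSpace.single j 1))^2

lemma gradSq_nonneg (d : ℕ) (f : EuclideanSpace ℝ (Fin d) → ℝ) (x) : 0 ≤ gradSq d f x :=
  Finset.sum_nonneg fun _ _ => sq_nonneg _

lemma norm_gradient_sq (d : ℕ) (f : EuclideanSpace ℝ (Fin d) → ℝ) (x) :
    ‖gradient f x‖^2 = gradSq d f x := by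
  rw [EuclideanSpace.norm_sq_eq, gradSq]
  refine Finset.sum_congr rfl fun j _ => ?_
  have : gradient f x j = fderiv ℝ f x (EuclideanSpace.single j 1) := by
    rw [← InnerProductSpace.toDual_symm_apply (x := EuclideanSpace.single j (1:ℝ)),
      EuclideanSpace.inner_single_right]
    simp [gradient]
  rw [this, Real.norm_eq_abs, sq_abs]

lemma fderiv_apply_sq_le (d : ℕ) (f : EuclideanSpace ℝ (Fin d) → ℝ) (x z) :
    (fderiv ℝ f x z)^2 ≤ ‖z‖^2 * gradSq d f x := by
  rw [← norm_gradient_sq, ← mul_pow, ← InnerProductSpace.toDual_symm_apply, ← sq_abs]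
  have := abs_real_inner_le_norm (gradient f x) z
  rw [mul_comm]
  exact pow_le_pow_left₀ (abs_nonneg _) this 2

lemma continuous_gradSq {d : ℕ} {f : EuclideanSpace ℝ (Fin d) → ℝ} (hf : ContDiff ℝ 1 f) :
    Continuous (gradSq d f) := by
  have := hf.continuous_fderiv one_ne_zero
  unfold gradSq
  fun_prop

lemma isOpen_openCube (d : ℕ) : IsOpen (openCube d) := by
  simp only [openCube, Set.ofPred_forall]
  exact isOpen_iInter_of_finite fun i => isOpen_Ioo.preimage (by fun_prop)

lemma measurableSet_openCube (d : ℕ) : MeasurableSet (openCube d) :=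
  (isOpen_openCube d).measurableSet

lemma openCube_subset_closedCube (d : ℕ) : openCube d ⊆ closedCube d :=
  fun _ hx i => Set.Ioo_subset_Icc_self (hx i)

lemma convex_openCube (d : ℕ) : Convex ℝ (openCube d) := by
  intro x hx y hy a b ha hb hab i
  exact convex_Ioo (0:ℝ) 1 (hx i) (hy i) ha hb hab

lemma isCompact_closedCube (d : ℕ) : IsCompact (closedCube d) := by
  have h : closedCube d = (EuclideanSpace.equiv (Fin d) ℝ).toHomeomorph ⁻¹'
      (Set.univ.pi fun _ => Set.Icc (0:ℝ) 1) := by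
    ext x; simp only [closedCube, Set.mem_ofPred_eq, Set.mem_preimage, Set.mem_univ_pi]; rfl
  rw [h]
  exact (Homeomorph.isCompact_preimage _).2 (isCompact_univ_pi fun _ => isCompact_Icc)

lemma volume_openCube (d : ℕ) : volume (openCube d) = 1 := by
  have h : openCube d = WithLp.ofLp ⁻¹' (Set.univ.pi fun _ : Fin d => Set.Ioo (0:ℝ) 1) := by
    ext x; simp [openCube]
  rw [h, (PiLp.volume_preserving_ofLp (Fin d)).measure_preimage
    (MeasurableSet.univ_pi fun _ => measurableSet_Ioo).nullMeasurableSet, volume_pi_pi]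
  simp

lemma Continuous.integrableOn_openCube {d : ℕ} {f : EuclideanSpace ℝ (Fin d) → ℝ}
    (hf : Continuous f) : IntegrableOn f (openCube d) :=
  (hf.continuousOn.integrableOn_compact (isCompact_closedCube d)).mono_set
    (openCube_subset_closedCube d)

/-- Jensen's inequality for the square on a probability space. -/
lemma sq_integral_le {α : Type*} [MeasurableSpace α] {μ : Measure α} [IsProbabilityMeasure μ]
    {g : α → ℝ} (hg : Integrable g μ) (hg2 : Integrable (fun x => g x ^ 2) μ) :
    (∫ x, g x ∂μ)^2 ≤ ∫ x, g x ^ 2 ∂μ :=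
  (even_two.convexOn_pow (𝕜 := ℝ)).map_integral_le (by fun_prop) isClosed_univ
    (by simp) hg hg2

/-- Along a segment, the squared increment is at most the averaged squared gradient. -/
lemma sq_sub_le_lintegral_gradSq {d : ℕ} {f : EuclideanSpace ℝ (Fin d) → ℝ} (hf : ContDiff ℝ 1 f)
    (x z : EuclideanSpace ℝ (Fin d)) :
    ENNReal.ofReal ((f (x + z) - f x)^2) ≤
      ∫⁻ t in Set.Ioc (0:ℝ) 1, ENNReal.ofReal (‖z‖^2 * gradSq d f (x + t • z)) := by
  have hc := hf.continuous_fderiv one_ne_zero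
  have hg := continuous_gradSq hf
  have h1 : ∫ t in (0:ℝ)..1, fderiv ℝ f (x + t • z) z = f (x + z) - f x := by
    have := intervalIntegral.integral_eq_sub_of_hasDerivAt (a := 0) (b := 1)
      (f := fun t : ℝ => f (x + t • z)) (f' := fun t => fderiv ℝ f (x + t • z) z)
      (fun t _ => by
        have h2 : HasDerivAt (fun t : ℝ => x + t • z) z t := by
          simpa using ((hasDerivAt_id t).smul_const z).const_add x
        exact ((hf.differentiable one_ne_zero _).hasFDerivAt).comp_hasDerivAt t h2)
      (Continuous.intervalIntegrable (by fun_prop) _ _)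
    simpa using this
  rw [intervalIntegral.integral_of_le zero_le_one] at h1
  have : IsProbabilityMeasure (volume.restrict (Set.Ioc (0:ℝ) 1)) := ⟨by simp⟩
  have hint : ∀ g : ℝ → ℝ, Continuous g → IntegrableOn g (Set.Ioc 0 1) := fun g hg =>
    (intervalIntegrable_iff_integrableOn_Ioc_of_le zero_le_one).1 (hg.intervalIntegrable _ _)
  rw [← h1, ← ofReal_integral_eq_lintegral_ofReal (hint _ (by fun_prop))
    (ae_of_all _ fun t => mul_nonneg (sq_nonneg _) (gradSq_nonneg _ _ _))]
  refine ENNReal.ofReal_le_ofReal ((sq_integral_le (hint _ (by fun_prop))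
    (hint _ (by fun_prop))).trans ?_)
  exact integral_mono (hint _ (by fun_prop)) (hint _ (by fun_prop))
    fun t => fderiv_apply_sq_le d f _ z

lemma lintegral_sq_translate_sub_le {d : ℕ} {f : EuclideanSpace ℝ (Fin d) → ℝ}
    (hf : ContDiff ℝ 1 f) (z : EuclideanSpace ℝ (Fin d)) :
    ∫⁻ x in {x | x ∈ openCube d ∧ x + z ∈ openCube d}, ENNReal.ofReal ((f (x + z) - f x)^2) ≤
      ENNReal.ofReal (‖z‖^2) * ∫⁻ x in openCube d, ENNReal.ofReal (gradSq d f x) := by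
  have hg := continuous_gradSq hf
  have hmeas : MeasurableSet {x | x ∈ openCube d ∧ x + z ∈ openCube d} :=
    (measurableSet_openCube d).inter ((measurableSet_openCube d).preimage
      (measurable_id.add_const z))
  calc _ ≤ ∫⁻ x in {x | x ∈ openCube d ∧ x + z ∈ openCube d}, ∫⁻ t in Set.Ioc (0:ℝ) 1,
          ENNReal.ofReal (‖z‖^2 * gradSq d f (x + t • z)) :=
        lintegral_mono fun x => sq_sub_le_lintegral_gradSq hf x z
    _ = ∫⁻ t in Set.Ioc (0:ℝ) 1, ∫⁻ x in {x | x ∈ openCube d ∧ x + z ∈ openCube d},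
          ENNReal.ofReal (‖z‖^2 * gradSq d f (x + t • z)) := by
        refine lintegral_lintegral_swap (Measurable.aemeasurable ?_)
        unfold Function.uncurry
        exact (Continuous.measurable (by fun_prop)).ennreal_ofReal
    _ ≤ ∫⁻ t in Set.Ioc (0:ℝ) 1, ENNReal.ofReal (‖z‖^2) *
          ∫⁻ x in openCube d, ENNReal.ofReal (gradSq d f x) := by
        refine setLIntegral_mono' measurableSet_Ioc fun t ht => ?_
        rw [← lintegral_const_mul' _ _ ENNReal.ofReal_ne_top,
          ← lintegral_indicator (measurableSet_openCube d),
          ← lintegral_add_right_eq_self ((openCube d).indicator _) (t • z),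
          ← lintegral_indicator hmeas]
        refine lintegral_mono fun y => ?_
        by_cases hy : y ∈ {x | x ∈ openCube d ∧ x + z ∈ openCube d}
        swap
        · rw [Set.indicator_of_notMem hy]; exact zero_le
        rw [Set.indicator_of_mem hy]
        have hmem : y + t • z ∈ openCube d :=
          (convex_openCube d).add_smul_mem hy.1 hy.2 ⟨ht.1.le, ht.2⟩
        rw [Set.indicator_of_mem hmem, ENNReal.ofReal_mul (sq_nonneg _)]
    _ = _ := by simp

/-- The local mean square oscillation of `f` around `x`, over a ball of radius `r`. -/
def localOsc (d : ℕ) (r : ℝ) (f : EuclideanSpace ℝ (Fin d) → ℝ) (x : EuclideanSpace ℝ (Fin d)) :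
    ℝ :=
  ∫ y in openCube d ∩ Metric.closedBall x r, (f y - f x)^2

lemma localOsc_nonneg (d : ℕ) (r : ℝ) (f : EuclideanSpace ℝ (Fin d) → ℝ) (x) :
    0 ≤ localOsc d r f x :=
  integral_nonneg fun _ => sq_nonneg _

lemma lintegral_localOsc_le {d : ℕ} {f : EuclideanSpace ℝ (Fin d) → ℝ} (hf : ContDiff ℝ 1 f)
    (r : ℝ) :
    ∫⁻ x in openCube d, ENNReal.ofReal (localOsc d r f x) ≤
      volume (Metric.closedBall (0 : EuclideanSpace ℝ (Fin d)) r) *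
       (ENNReal.ofReal (r^2) * ∫⁻ x in openCube d, ENNReal.ofReal (gradSq d f x)) := by
  have hcf := hf.continuous
  have hS : MeasurableSet {p : EuclideanSpace ℝ (Fin d) × EuclideanSpace ℝ (Fin d) |
      p.1 ∈ openCube d ∧ p.1 + p.2 ∈ openCube d ∧ p.2 ∈ Metric.closedBall 0 r} := by
    refine ((measurableSet_openCube d).preimage measurable_fst).inter
      (((measurableSet_openCube d).preimage (measurable_fst.add measurable_snd)).inter
        (measurableSet_closedBall.preimage measurable_snd))
  set S := {p : EuclideanSpace ℝ (Fin d) × EuclideanSpace ℝ (Fin d) |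
      p.1 ∈ openCube d ∧ p.1 + p.2 ∈ openCube d ∧ p.2 ∈ Metric.closedBall 0 r} with hSdef
  set F : EuclideanSpace ℝ (Fin d) × EuclideanSpace ℝ (Fin d) → ENNReal :=
    S.indicator fun p => ENNReal.ofReal ((f (p.1 + p.2) - f p.1)^2) with hF
  calc _ ≤ ∫⁻ x, ∫⁻ z, F (x, z) := by
        rw [← lintegral_indicator (measurableSet_openCube d)]
        refine lintegral_mono fun x => ?_
        by_cases hx : x ∈ openCube d
        swap
        · rw [Set.indicator_of_notMem hx]; exact zero_le
        rw [Set.indicator_of_mem hx]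
        have hm : MeasurableSet (openCube d ∩ Metric.closedBall x r) :=
          (measurableSet_openCube d).inter measurableSet_closedBall
        rw [localOsc, ofReal_integral_eq_lintegral_ofReal
          ((Continuous.integrableOn_openCube (by fun_prop)).mono_set Set.inter_subset_left)
          (ae_of_all _ fun _ => sq_nonneg _), ← lintegral_indicator hm,
          ← lintegral_add_left_eq_self _ x]
        refine lintegral_mono fun z => ?_
        simp only [hF, hSdef]
        by_cases h : x + z ∈ openCube d ∩ Metric.closedBall x r
        · rw [Set.indicator_of_mem h, Set.indicator_of_mem]
          exact ⟨hx, h.1, by simpa using h.2⟩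
        · rw [Set.indicator_of_notMem h]; exact zero_le
    _ = ∫⁻ z, ∫⁻ x, F (x, z) := by
        refine lintegral_lintegral_swap (Measurable.aemeasurable ?_)
        exact (Continuous.measurable (by fun_prop)).ennreal_ofReal.indicator hS
    _ ≤ ∫⁻ z in Metric.closedBall (0 : EuclideanSpace ℝ (Fin d)) r,
          (ENNReal.ofReal (r^2) * ∫⁻ x in openCube d, ENNReal.ofReal (gradSq d f x)) := by
        rw [← lintegral_indicator measurableSet_closedBall]
        refine lintegral_mono fun z => ?_
        by_cases hz : z ∈ Metric.closedBall (0 : EuclideanSpace ℝ (Fin d)) r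
        · rw [Set.indicator_of_mem hz]
          have hmeas : MeasurableSet {x | x ∈ openCube d ∧ x + z ∈ openCube d} :=
            (measurableSet_openCube d).inter ((measurableSet_openCube d).preimage
              (measurable_id.add_const z))
          have h1 : ∫⁻ x, F (x, z) = ∫⁻ x in {x | x ∈ openCube d ∧ x + z ∈ openCube d},
              ENNReal.ofReal ((f (x + z) - f x)^2) := by
            rw [← lintegral_indicator hmeas]
            refine lintegral_congr fun x => ?_
            by_cases hx : x ∈ {x | x ∈ openCube d ∧ x + z ∈ openCube d}
            · have hS' : (x, z) ∈ S := ⟨hx.1, hx.2, hz⟩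
              rw [hF, Set.indicator_of_mem hS',
                Set.indicator_of_mem hx]
            · rw [hF, Set.indicator_of_notMem (fun h : (x, z) ∈ S => hx ⟨h.1, h.2.1⟩),
                Set.indicator_of_notMem hx]
          rw [h1]
          refine (lintegral_sq_translate_sub_le hf z).trans ?_
          gcongr
          simpa using hz
        · rw [Set.indicator_of_notMem hz]
          have h1 : ∀ x, F (x, z) = 0 := fun x =>
            Set.indicator_of_notMem (fun h => hz h.2.2) _
          simp [h1]
    _ = _ := by rw [setLIntegral_const, mul_comm]

lemma aestronglyMeasurable_localOsc {d : ℕ} {f : EuclideanSpace ℝ (Fin d) → ℝ}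
    (hf : Continuous f) (r : ℝ) : AEStronglyMeasurable (localOsc d r f) := by
  have hS : MeasurableSet {p : EuclideanSpace ℝ (Fin d) × EuclideanSpace ℝ (Fin d) |
      p.2 ∈ openCube d ∧ dist p.2 p.1 ≤ r} :=
    ((measurableSet_openCube d).preimage measurable_snd).inter
      (measurableSet_le (measurable_snd.dist measurable_fst) measurable_const)
  have h : localOsc d r f = fun x => ∫ y, {p : EuclideanSpace ℝ (Fin d) ×
      EuclideanSpace ℝ (Fin d) | p.2 ∈ openCube d ∧ dist p.2 p.1 ≤ r}.indicator
      (fun p => (f p.2 - f p.1)^2) (x, y) := by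
    ext x
    rw [localOsc, ← integral_indicator
      ((measurableSet_openCube d).inter measurableSet_closedBall)]
    rfl
  rw [h]
  refine StronglyMeasurable.aestronglyMeasurable ?_
  refine StronglyMeasurable.integral_prod_right' (f := {p : EuclideanSpace ℝ (Fin d) ×
      EuclideanSpace ℝ (Fin d) | p.2 ∈ openCube d ∧ dist p.2 p.1 ≤ r}.indicator
      (fun p => (f p.2 - f p.1)^2)) ?_
  exact (Continuous.stronglyMeasurable (by fun_prop)).indicator hS

/-- The integrated local oscillation is controlled by the Dirichlet energy. -/
lemma integral_localOsc_le {d : ℕ} {f : EuclideanSpace ℝ (Fin d) → ℝ} (hf : ContDiff ℝ 1 f)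
    {r : ℝ} (hr : 0 ≤ r) :
    IntegrableOn (localOsc d r f) (openCube d) ∧
    ∫ x in openCube d, localOsc d r f x ≤
      r^(d+2) * (volume (Metric.ball (0 : EuclideanSpace ℝ (Fin d)) 1)).toReal *
        ∫ x in openCube d, gradSq d f x := by
  have h := lintegral_localOsc_le hf r
  rw [← ofReal_integral_eq_lintegral_ofReal (continuous_gradSq hf).integrableOn_openCube
    (ae_of_all _ fun _ => gradSq_nonneg _ _ _), Measure.addHaar_closedBall _ _ hr,
    ← ENNReal.ofReal_toReal (Metric.isBounded_ball (x := (0 : EuclideanSpace ℝ (Fin d)))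
      (r := 1)).measure_lt_top.ne,
    ← ENNReal.ofReal_mul (by positivity), ← ENNReal.ofReal_mul (by positivity),
    ← ENNReal.ofReal_mul (by positivity), finrank_euclideanSpace_fin] at h
  have hm := (aestronglyMeasurable_localOsc hf.continuous r).restrict (s := openCube d)
  have hnn : 0 ≤ ∫ x in openCube d, gradSq d f x := integral_nonneg fun _ => gradSq_nonneg _ _ _
  constructor
  · refine ⟨hm, ?_⟩
    rw [hasFiniteIntegral_iff_ofReal (ae_of_all _ fun _ => localOsc_nonneg _ _ _ _)]
    exact h.trans_lt ENNReal.ofReal_lt_top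
  · rw [integral_eq_lintegral_of_nonneg_ae (ae_of_all _ fun _ => localOsc_nonneg _ _ _ _) hm]
    refine (ENNReal.toReal_mono ENNReal.ofReal_ne_top h).trans ?_
    rw [ENNReal.toReal_ofReal (by positivity)]
    apply le_of_eq; ring

/-- The average of `f` over the cube `a + η (0,1)^d`. -/
def cubeAvg (d : ℕ) (η : ℝ) (f : EuclideanSpace ℝ (Fin d) → ℝ) (a : EuclideanSpace ℝ (Fin d)) : ℝ :=
  ∫ z in openCube d, f (η • z + a)

lemma sq_cubeAvg_sub_le {d : ℕ} {f : EuclideanSpace ℝ (Fin d) → ℝ} (hf : Continuous f) {η r : ℝ}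
    (hη : 0 < η) {a x : EuclideanSpace ℝ (Fin d)}
    (ha : ∀ z ∈ openCube d, η • z + a ∈ openCube d ∩ Metric.closedBall x r) :
    (cubeAvg d η f a - f x)^2 ≤ (η^d)⁻¹ * localOsc d r f x := by
  have : IsProbabilityMeasure (volume.restrict (openCube d)) := ⟨by simp [volume_openCube]⟩
  have hm : MeasurableSet (openCube d ∩ Metric.closedBall x r) :=
    (measurableSet_openCube d).inter measurableSet_closedBall
  have h1 : cubeAvg d η f a - f x = ∫ z in openCube d, (f (η • z + a) - f x) := by
    rw [integral_sub (Continuous.integrableOn_openCube (by fun_prop))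
      (Continuous.integrableOn_openCube (by fun_prop))]
    simp [cubeAvg]
  set g := (openCube d ∩ Metric.closedBall x r).indicator (fun y => (f y - f x)^2) with hg
  have hgi : Integrable g := (integrable_indicator_iff hm).2
    ((Continuous.integrableOn_openCube (by fun_prop)).mono_set Set.inter_subset_left)
  have hg0 : ∀ y, 0 ≤ g y := fun y => Set.indicator_nonneg (fun _ _ => sq_nonneg _) y
  calc (cubeAvg d η f a - f x)^2 ≤ ∫ z in openCube d, (f (η • z + a) - f x)^2 := by
        rw [h1]
        exact sq_integral_le (Continuous.integrableOn_openCube (by fun_prop))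
          (Continuous.integrableOn_openCube (by fun_prop))
    _ = ∫ z in openCube d, g (η • z + a) := by
        refine setIntegral_congr_fun (measurableSet_openCube d) fun z hz => ?_
        rw [hg, Set.indicator_of_mem (ha z hz)]
    _ ≤ ∫ z, g (η • z + a) :=
        setIntegral_le_integral ((hgi.comp_add_right a).comp_smul hη.ne')
          (ae_of_all _ fun z => hg0 _)
    _ = (η^d)⁻¹ * localOsc d r f x := by
        rw [Measure.integral_comp_smul volume (fun y => g (y + a)), integral_add_right_eq_self,
          hg, integral_indicator hm, finrank_euclideanSpace_fin, abs_of_pos (by positivity)]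
        rfl

lemma hasDerivAt_cubeAvg {d : ℕ} {f : EuclideanSpace ℝ (Fin d) → ℝ} (hf : ContDiff ℝ 1 f) (η : ℝ)
    (a w : EuclideanSpace ℝ (Fin d)) (s : ℝ) :
    HasDerivAt (fun s : ℝ => cubeAvg d η f (a + s • w))
      (cubeAvg d η (fun y => fderiv ℝ f y w) (a + s • w)) s := by
  have hc := hf.continuous_fderiv one_ne_zero
  have hcf := hf.continuous
  obtain ⟨C, hC⟩ := ((isCompact_Icc (a := s - 1) (b := s + 1)).prod
    (isCompact_closedCube d)).exists_bound_of_continuousOn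
    (f := fun p : ℝ × EuclideanSpace ℝ (Fin d) => fderiv ℝ f (η • p.2 + (a + p.1 • w)) w)
    (by fun_prop)
  refine (hasDerivAt_integral_of_dominated_loc_of_deriv_le (μ := volume.restrict (openCube d))
    (F := fun s z => f (η • z + (a + s • w)))
    (F' := fun s z => fderiv ℝ f (η • z + (a + s • w)) w) (bound := fun _ => C)
    (s := Set.Icc (s - 1) (s + 1)) (Icc_mem_nhds (by linarith) (by linarith)) ?_ ?_ ?_ ?_ ?_ ?_).2
  · exact Filter.Eventually.of_forall fun t => Continuous.aestronglyMeasurable (by fun_prop)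
  · exact Continuous.integrableOn_openCube (by fun_prop)
  · exact Continuous.aestronglyMeasurable (by fun_prop)
  · exact (ae_restrict_mem (measurableSet_openCube d)).mono fun z hz t ht =>
      hC (t, z) ⟨ht, openCube_subset_closedCube d hz⟩
  · exact Continuous.integrableOn_openCube continuous_const
  · refine ae_of_all _ fun z t _ => ?_
    have h2 : HasDerivAt (fun t : ℝ => η • z + (a + t • w)) w t := by
      simpa using (((hasDerivAt_id t).smul_const w).const_add a).const_add (η • z)
    exact ((hf.differentiable one_ne_zero _).hasFDerivAt).comp_hasDerivAt t h2

lemma exists_cubeAvg_sub_eq {d : ℕ} {f : EuclideanSpace ℝ (Fin d) → ℝ} (hf : ContDiff ℝ 1 f)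
    (η : ℝ) (a w : EuclideanSpace ℝ (Fin d)) :
    ∃ s ∈ Set.Ioo (0:ℝ) 1, cubeAvg d η f (a + w) - cubeAvg d η f a =
      cubeAvg d η (fun y => fderiv ℝ f y w) (a + s • w) := by
  obtain ⟨s, hs, h⟩ := exists_hasDerivAt_eq_slope (fun s : ℝ => cubeAvg d η f (a + s • w))
    (fun s => cubeAvg d η (fun y => fderiv ℝ f y w) (a + s • w)) zero_lt_one
    (fun s _ => (hasDerivAt_cubeAvg hf η a w s).continuousAt.continuousWithinAt)
    (fun s _ => hasDerivAt_cubeAvg hf η a w s)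
  exact ⟨s, hs, by simpa using h.symm⟩

/-- The quadratic B-spline with knots `0, 1, 2, 3`. -/
def quadSpline (t : ℝ) : ℝ :=
  ((max t 0)^2 - 3 * (max (t - 1) 0)^2 + 3 * (max (t - 2) 0)^2 - (max (t - 3) 0)^2) / 2

/-- The linear B-spline with knots `0, 1, 2`. -/
def hatSpline (t : ℝ) : ℝ := max t 0 - 2 * max (t - 1) 0 + max (t - 2) 0

lemma bspline_eq_quadSpline (l : ℕ) (i : ℤ) (x : ℝ) :
    bspline l i x = quadSpline (2^l * x - i) := by
  have hn : (0:ℝ) < 2^l := by positivity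
  have key : ∀ j : ℝ, (2:ℝ)^(2*l) * (max (x - ((i:ℝ) + j) * (2:ℝ)^(-(l:ℤ))) 0)^2 =
      (max (2^l * x - i - j) 0)^2 := fun j => by
    rw [mul_comm 2 l, pow_mul, ← mul_pow, mul_max_of_nonneg _ _ hn.le, mul_zero, zpow_neg,
      zpow_natCast]
    congr 2
    field_simp
    ring
  have h2 : (2:ℝ)^(2 * (l:ℤ) - 1) = 2^(2*l) / 2 := by
    rw [zpow_sub_one₀ two_ne_zero, div_eq_mul_inv]; norm_cast
  have k0 := key 0
  have k1 := key 1
  have k2 := key 2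
  have k3 := key 3
  rw [sub_zero] at k0
  rw [bspline, h2, quadSpline, ← k0, ← k1, ← k2, ← k3]
  simp [Finset.sum_range_succ, Nat.choose]
  ring

lemma quadSpline_nonneg (t : ℝ) : 0 ≤ quadSpline t := by
  unfold quadSpline
  rcases max_cases t 0 with h0 | h0 <;> rcases max_cases (t - 1) 0 with h1 | h1 <;>
  rcases max_cases (t - 2) 0 with h2 | h2 <;> rcases max_cases (t - 3) 0 with h3 | h3 <;>
  rw [h0.1, h1.1, h2.1, h3.1] <;> nlinarith

lemma hatSpline_nonneg (t : ℝ) : 0 ≤ hatSpline t := by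
  unfold hatSpline
  rcases max_cases t 0 with h0 | h0 <;> rcases max_cases (t - 1) 0 with h1 | h1 <;>
  rcases max_cases (t - 2) 0 with h2 | h2 <;> linarith

lemma mem_Ioo_of_quadSpline_ne_zero {t : ℝ} (h : quadSpline t ≠ 0) : t ∈ Set.Ioo (0:ℝ) 3 := by
  by_contra ht
  refine h ?_
  rw [Set.mem_Ioo, not_and_or, not_lt, not_lt] at ht
  unfold quadSpline
  rcases ht with ht | ht
  · rw [max_eq_right ht, max_eq_right (by linarith), max_eq_right (by linarith),
      max_eq_right (by linarith)]
    ring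
  · rw [max_eq_left (by linarith), max_eq_left (by linarith), max_eq_left (by linarith),
      max_eq_left (by linarith)]
    ring

lemma mem_Ioo_of_hatSpline_ne_zero {t : ℝ} (h : hatSpline t ≠ 0) : t ∈ Set.Ioo (0:ℝ) 2 := by
  by_contra ht
  refine h ?_
  rw [Set.mem_Ioo, not_and_or, not_lt, not_lt] at ht
  unfold hatSpline
  rcases ht with ht | ht
  · rw [max_eq_right ht, max_eq_right (by linarith), max_eq_right (by linarith)]
    ring
  · rw [max_eq_left (by linarith), max_eq_left (by linarith), max_eq_left (by linarith)]
    ring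

lemma hasDerivAt_max_zero_sq (t : ℝ) : HasDerivAt (fun t : ℝ => (max t 0)^2) (2 * max t 0) t := by
  rcases lt_trichotomy t 0 with ht | rfl | ht
  · rw [max_eq_right ht.le, mul_zero]
    refine (hasDerivAt_const t (0:ℝ)).congr_of_eventuallyEq ?_
    filter_upwards [Iio_mem_nhds ht] with s hs
    rw [max_eq_right (le_of_lt hs)]; simp
  · rw [max_self, mul_zero, hasDerivAt_iff_isLittleO]
    refine Asymptotics.IsBigO.trans_isLittleO (g := fun x : ℝ => x^2) ?_ ?_
    · refine Asymptotics.IsBigO.of_bound 1 (Filter.Eventually.of_forall fun x => ?_)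
      rcases max_cases x 0 with h | h <;> simp [h.1]
      positivity
    · simpa using Asymptotics.isLittleO_pow_id (𝕜 := ℝ) one_lt_two
  · rw [max_eq_left ht.le]
    have : HasDerivAt (fun t : ℝ => t^2) (2 * t) t := by simpa using hasDerivAt_pow 2 t
    refine this.congr_of_eventuallyEq ?_
    filter_upwards [Ioi_mem_nhds ht] with s hs
    rw [max_eq_left (le_of_lt hs)]

lemma hasDerivAt_quadSpline (t : ℝ) :
    HasDerivAt quadSpline (hatSpline t - hatSpline (t - 1)) t := by
  have h : ∀ c, HasDerivAt (fun t : ℝ => (max (t - c) 0)^2) (2 * max (t - c) 0) t := fun c =>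
    (hasDerivAt_max_zero_sq (t - c)).comp_sub_const t c
  have := ((((hasDerivAt_max_zero_sq t).sub ((h 1).const_mul 3)).add ((h 2).const_mul 3)).sub
    (h 3)).div_const 2
  refine this.congr_deriv ?_
  rw [hatSpline, hatSpline, show t - 1 - 1 = t - 2 by ring, show t - 1 - 2 = t - 3 by ring]
  ring

lemma sum_Ioo_sub_int (D : ℤ → ℝ) {a b : ℤ} (hab : a < b) :
    ∑ i ∈ Finset.Ioo a b, (D i - D (i + 1)) = D (a + 1) - D b := by
  induction b, (show a + 1 ≤ b by omega) using Int.leInduction with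
  | base =>
    have : Finset.Ioo a (a + 1) = ∅ := by ext; simp
    simp [this]
  | succ b hb ih =>
    have : Finset.Ioo a (b + 1) = insert b (Finset.Ioo a b) := by ext; simp; omega
    rw [this, Finset.sum_insert (by simp), ih (by omega)]
    ring

lemma sum_quadSpline {n : ℕ} {t : ℝ} (h0 : 0 < t) (hn : t < n) :
    ∑ i ∈ Finset.Ioo (-3:ℤ) n, quadSpline (t - i) = 1 := by
  have := sum_Ioo_sub_int (fun i => ((max (t - i) 0)^2 - 2 * (max (t - i - 1) 0)^2 +
    (max (t - i - 2) 0)^2) / 2) (a := -3) (b := n) (by omega)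
  rw [max_eq_left (by push_cast; linarith), max_eq_left (by push_cast; linarith),
    max_eq_left (by push_cast; linarith), max_eq_right (by push_cast; linarith),
    max_eq_right (by push_cast; linarith), max_eq_right (by push_cast; linarith)] at this
  refine (Finset.sum_congr rfl fun i _ => ?_).trans (this.trans (by push_cast; ring))
  push_cast
  rw [quadSpline, show t - (i + 1) = t - i - 1 by ring, show t - i - 1 - 1 = t - i - 2 by ring,
    show t - i - 1 - 2 = t - i - 3 by ring]
  ring

lemma sum_hatSpline {n : ℕ} {t : ℝ} (h0 : 0 < t) (hn : t < n) :
    ∑ i ∈ Finset.Ioo (-2:ℤ) n, hatSpline (t - i) = 1 := by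
  have := sum_Ioo_sub_int (fun i => max (t - i) 0 - max (t - i - 1) 0) (a := -2) (b := n) (by omega)
  rw [max_eq_left (by push_cast; linarith), max_eq_left (by push_cast; linarith),
    max_eq_right (by push_cast; linarith), max_eq_right (by push_cast; linarith)] at this
  refine (Finset.sum_congr rfl fun i _ => ?_).trans (this.trans (by push_cast; ring))
  push_cast
  rw [hatSpline, show t - (i + 1) = t - i - 1 by ring, show t - i - 1 - 1 = t - i - 2 by ring]
  ring

/-- A tensor product of partitions of unity averages values close to `v` to a value close to `v`. -/
lemma sq_sum_mul_prod_sub_le {d : ℕ} {φ : Fin d → ℤ → ℝ} {A : Fin d → Finset ℤ}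
    (hφ : ∀ j k, 0 ≤ φ j k) (hsum : ∀ j, ∑ k ∈ A j, φ j k = 1) {c : (Fin d → ℤ) → ℝ} {v M : ℝ}
    (h : ∀ i ∈ Fintype.piFinset A, (∀ j, φ j (i j) ≠ 0) → (c i - v)^2 ≤ M) :
    (∑ i ∈ Fintype.piFinset A, c i * ∏ j, φ j (i j) - v)^2 ≤ M := by
  have h1 : ∑ i ∈ Fintype.piFinset A, ∏ j, φ j (i j) = 1 := by
    rw [← Finset.prod_univ_sum]; simp [hsum]
  have h2 : ∑ i ∈ Fintype.piFinset A, c i * ∏ j, φ j (i j) - v =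
      ∑ i ∈ Fintype.piFinset A, (∏ j, φ j (i j)) * (c i - v) := by
    simp_rw [mul_sub, Finset.sum_sub_distrib, ← Finset.sum_mul, h1, mul_comm (c _), one_mul]
  rw [h2]
  calc _ ≤ ∑ i ∈ Fintype.piFinset A, (∏ j, φ j (i j)) * (c i - v)^2 :=
        Real.pow_arith_mean_le_arith_mean_pow_of_even _ _ _
          (fun i _ => Finset.prod_nonneg fun j _ => hφ _ _) h1 even_two
    _ ≤ ∑ i ∈ Fintype.piFinset A, (∏ j, φ j (i j)) * M := by
        refine Finset.sum_le_sum fun i hi => ?_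
        by_cases hz : ∀ j, φ j (i j) ≠ 0
        · exact mul_le_mul_of_nonneg_left (h i hi hz) (Finset.prod_nonneg fun j _ => hφ _ _)
        · push Not at hz
          obtain ⟨j, hj⟩ := hz
          have h0 : ∏ j, φ j (i j) = 0 := Finset.prod_eq_zero (Finset.mem_univ j) hj
          simp [h0]
    _ = M := by rw [← Finset.sum_mul, h1, one_mul]

lemma hasFDerivAt_bsplineMulti (d l : ℕ) (i : Fin d → ℤ) (x : EuclideanSpace ℝ (Fin d)) :
    HasFDerivAt (bsplineMulti d l i)
      (∑ k, (∏ j ∈ Finset.univ.erase k, quadSpline (2^l * x j - i j)) •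
        (((hatSpline (2^l * x k - i k) - hatSpline (2^l * x k - i k - 1)) * 2^l) •
          (EuclideanSpace.proj k : EuclideanSpace ℝ (Fin d) →L[ℝ] ℝ))) x := by
  have h : bsplineMulti d l i = fun x => ∏ j, quadSpline (2^l * x j - i j) := by
    ext x; simp [bsplineMulti, bspline_eq_quadSpline]
  rw [h]
  refine HasFDerivAt.finsetProd fun k _ => ?_
  have h1 : HasDerivAt (fun s : ℝ => quadSpline (2^l * s - i k))
      ((hatSpline (2^l * x k - i k) - hatSpline (2^l * x k - i k - 1)) * 2^l) (x k) := by
    refine (hasDerivAt_quadSpline _).comp (x k) ?_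
    simpa using ((hasDerivAt_id (x k)).const_mul ((2:ℝ)^l)).sub_const (i k : ℝ)
  exact h1.comp_hasFDerivAt x (EuclideanSpace.proj k : EuclideanSpace ℝ (Fin d) →L[ℝ] ℝ).hasFDerivAt

lemma fderiv_bsplineMulti_single (d l : ℕ) (i : Fin d → ℤ) (x : EuclideanSpace ℝ (Fin d))
    (m : Fin d) :
    fderiv ℝ (bsplineMulti d l i) x (EuclideanSpace.single m 1) =
      2^l * ((hatSpline (2^l * x m - i m) - hatSpline (2^l * x m - i m - 1)) *
        ∏ j ∈ Finset.univ.erase m, quadSpline (2^l * x j - i j)) := by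
  rw [(hasFDerivAt_bsplineMulti d l i x).fderiv, sum_apply,
    Finset.sum_eq_single m]
  · simp; ring
  · intro k _ hk
    simp [hk]
  · simp

/-- Index sets of the splines that occur in the `m`-th partial derivative. -/
def derivIndex (d n : ℕ) (m : Fin d) (j : Fin d) : Finset ℤ :=
  if j = m then Finset.Ioo (-2) n else Finset.Ioo (-3) n

lemma sum_mul_sub_hatSpline {d n : ℕ} (m : Fin d) {t : ℝ} (ht : 0 < t) (htn : t < n)
    (c P : (Fin d → ℤ) → ℝ) (hP : ∀ i k, P (Function.update i m k) = P i) :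
    ∑ i ∈ Fintype.piFinset (fun _ : Fin d => Finset.Ioo (-3:ℤ) n),
      c i * ((hatSpline (t - i m) - hatSpline (t - i m - 1)) * P i) =
    ∑ i ∈ Fintype.piFinset (derivIndex d n m),
      (c i - c (Function.update i m (i m - 1))) * (hatSpline (t - i m) * P i) := by
  have hlt : ∀ k : ℤ, hatSpline (t - k) ≠ 0 → -2 < k ∧ k < n := fun k hk => by
    have := mem_Ioo_of_hatSpline_ne_zero hk
    constructor
    · have h : (-2:ℝ) < k := by linarith [this.2]
      exact_mod_cast h
    · have h : (k:ℝ) < n := by linarith [this.1]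
      exact_mod_cast h
  have h1 : ∑ i ∈ Fintype.piFinset (fun _ : Fin d => Finset.Ioo (-3:ℤ) n),
      c i * (hatSpline (t - i m) * P i) =
      ∑ i ∈ Fintype.piFinset (derivIndex d n m), c i * (hatSpline (t - i m) * P i) := by
    refine (Finset.sum_subset ?_ ?_).symm
    · refine Fintype.piFinset_subset _ _ fun j => ?_
      unfold derivIndex
      split_ifs
      · exact Finset.Ioo_subset_Ioo_left (by norm_num)
      · rfl
    · intro i hi hi'
      by_contra hne
      refine hi' (Fintype.mem_piFinset.2 fun j => ?_)
      unfold derivIndex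
      split_ifs with hj
      · subst hj
        exact Finset.mem_Ioo.2 (hlt _ (left_ne_zero_of_mul (right_ne_zero_of_mul hne)))
      · exact Fintype.mem_piFinset.1 hi j
  have h2 : ∑ i ∈ Fintype.piFinset (fun _ : Fin d => Finset.Ioo (-3:ℤ) n),
      c i * (hatSpline (t - i m - 1) * P i) =
      ∑ i ∈ Fintype.piFinset (derivIndex d n m),
        c (Function.update i m (i m - 1)) * (hatSpline (t - i m) * P i) := by
    refine Finset.sum_bij_ne_zero (fun i _ _ => Function.update i m (i m + 1)) ?_ ?_ ?_ ?_
    · intro i hi hne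
      refine Fintype.mem_piFinset.2 fun j => ?_
      unfold derivIndex
      split_ifs with hj
      · subst hj
        have := hlt (i j + 1) (by
          push_cast
          rw [← sub_sub]
          exact left_ne_zero_of_mul (right_ne_zero_of_mul hne))
        simpa using this
      · rw [Function.update_of_ne hj]
        exact Fintype.mem_piFinset.1 hi j
    · intro i _ _ i' _ _ h
      ext j
      have := congrFun h j
      by_cases hj : j = m
      · subst hj; simpa using this
      · simpa [hj] using this
    · intro i hi hne
      refine ⟨Function.update i m (i m - 1), Fintype.mem_piFinset.2 fun j => ?_, ?_, ?_⟩
      · have hj' := Fintype.mem_piFinset.1 hi j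
        unfold derivIndex at hj'
        split_ifs at hj' with hj
        · subst hj
          simp only [Function.update_self, Finset.mem_Ioo] at hj' ⊢
          omega
        · rwa [Function.update_of_ne hj]
      · simpa [hP, sub_sub] using hne
      · simp
    · intro i _ _
      simp [hP, sub_sub]
  simp_rw [sub_mul, mul_sub, Finset.sum_sub_distrib]
  rw [h1, h2]

lemma norm_le_of_forall_abs_le {d : ℕ} {v : EuclideanSpace ℝ (Fin d)} {ε : ℝ} (hε : 0 ≤ ε)
    (h : ∀ j, |v j| ≤ ε) : ‖v‖ ≤ d * ε := by
  refine abs_le_of_sq_le_sq' ?_ (by positivity) |>.2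
  rw [EuclideanSpace.norm_sq_eq]
  calc ∑ i, ‖v i‖^2 ≤ ∑ i : Fin d, ε^2 := Finset.sum_le_sum fun i _ =>
        pow_le_pow_left₀ (norm_nonneg _) (h i) 2
    _ = d * ε^2 := by simp
    _ ≤ (d * ε)^2 := by
        rw [mul_pow]
        refine mul_le_mul_of_nonneg_right ?_ (sq_nonneg _)
        exact_mod_cast Nat.le_self_pow two_ne_zero d

/-- The lower corner of the averaging cube attached to the multi-index `i`. -/
def cubeNode (d : ℕ) (η : ℝ) (i : Fin d → ℤ) : EuclideanSpace ℝ (Fin d) :=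
  WithLp.toLp 2 fun j => (i j + 2) * η

lemma cubeNode_update (d : ℕ) (η : ℝ) (i : Fin d → ℤ) (m : Fin d) :
    cubeNode d η i = cubeNode d η (Function.update i m (i m - 1)) +
      η • EuclideanSpace.single m (1:ℝ) := by
  ext j
  by_cases hj : j = m
  · subst hj; simp [cubeNode]; ring
  · simp [cubeNode, hj]

lemma mem_openCube_inter_closedBall {d n : ℕ} (hn : 0 < n) {x y : EuclideanSpace ℝ (Fin d)}
    {i : Fin d → ℤ} (hi : i ∈ Fintype.piFinset (fun _ : Fin d => Finset.Ioo (-3:ℤ) n))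
    (hx : ∀ j, n * x j - i j ∈ Set.Ioo (0:ℝ) 3)
    (hy : ∀ j, ((n:ℝ) + 2) * y j ∈ Set.Ioo ((i j : ℝ) + 1) (i j + 3))
    (hpos : ∀ j, 0 < y j) :
    y ∈ openCube d ∩ Metric.closedBall x (d * (4 / n)) := by
  have hn' : (0:ℝ) < n := by exact_mod_cast hn
  have hlt : ∀ j, y j < 1 := fun j => by
    have h1 : i j < n := (Finset.mem_Ioo.1 (Fintype.mem_piFinset.1 hi j)).2
    have h2 : (i j : ℝ) + 1 ≤ n := by exact_mod_cast h1
    by_contra hc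
    nlinarith [(hy j).2]
  refine ⟨fun j => ⟨hpos j, hlt j⟩, ?_⟩
  rw [mem_closedBall_iff_norm]
  refine norm_le_of_forall_abs_le (by positivity) fun j => ?_
  have h1 := hx j
  have h2 := hy j
  have h3 := hpos j
  have h4 := hlt j
  have h5 : |(n:ℝ) * (y j - x j)| ≤ 4 := abs_le.2
    ⟨by linarith [h1.2, h2.1], by linarith [h1.1, h2.2]⟩
  rw [abs_mul, abs_of_pos hn'] at h5
  rw [le_div_iff₀ hn', mul_comm]
  exact h5

/-- The quasi-interpolant of `u` of level `l`, whose coefficients are averages of `u`. -/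
def quasiInterp (d l : ℕ) (u : EuclideanSpace ℝ (Fin d) → ℝ) (x : EuclideanSpace ℝ (Fin d)) : ℝ :=
  ∑ i ∈ Fintype.piFinset (fun _ : Fin d => Finset.Ioo (-3:ℤ) (2^l)),
    cubeAvg d ((2:ℝ)^l + 2)⁻¹ u (cubeNode d ((2:ℝ)^l + 2)⁻¹ i) * bsplineMulti d l i x

lemma differentiable_quasiInterp (d l : ℕ) (u : EuclideanSpace ℝ (Fin d) → ℝ) :
    Differentiable ℝ (quasiInterp d l u) := by
  unfold quasiInterp
  exact Differentiable.fun_sum fun i _ =>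
    Differentiable.const_mul (fun x => (hasFDerivAt_bsplineMulti d l i x).differentiableAt) _

lemma two_pow_mul_mem_Ioo {d : ℕ} (l : ℕ) {x : EuclideanSpace ℝ (Fin d)} (hx : x ∈ openCube d)
    (j : Fin d) : 0 < 2^l * x j ∧ 2^l * x j < ((2^l : ℕ) : ℝ) := by
  have hn : (0:ℝ) < 2^l := by positivity
  have h := hx j
  refine ⟨mul_pos hn h.1, ?_⟩
  push_cast
  exact mul_lt_of_lt_one_right hn h.2

lemma sq_sub_quasiInterp_le {d : ℕ} (l : ℕ) {u : EuclideanSpace ℝ (Fin d) → ℝ} (hu : Continuous u)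
    {x : EuclideanSpace ℝ (Fin d)} (hx : x ∈ openCube d) :
    (u x - quasiInterp d l u x)^2 ≤
      ((2:ℝ)^l + 2)^d * localOsc d (d * (4 / 2^l)) u x := by
  have hη : (0:ℝ) < ((2:ℝ)^l + 2)⁻¹ := by positivity
  rw [← neg_sq, neg_sub]
  have h := sq_sum_mul_prod_sub_le (φ := fun j k => quadSpline (2^l * x j - k))
    (A := fun _ : Fin d => Finset.Ioo (-3:ℤ) ((2^l : ℕ) : ℤ))
    (c := fun i => cubeAvg d ((2:ℝ)^l + 2)⁻¹ u (cubeNode d ((2:ℝ)^l + 2)⁻¹ i)) (v := u x)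
    (M := ((2:ℝ)^l + 2)^d * localOsc d (d * (4 / 2^l)) u x) (fun j k => quadSpline_nonneg _)
    (fun j => sum_quadSpline (two_pow_mul_mem_Ioo l hx j).1 (two_pow_mul_mem_Ioo l hx j).2) ?_
  · simpa only [quasiInterp, bsplineMulti, bspline_eq_quadSpline, Nat.cast_pow, Nat.cast_ofNat]
      using h
  · intro i hi hne
    have h1 := sq_cubeAvg_sub_le hu hη (r := d * (4 / 2^l)) (x := x)
      (a := cubeNode d ((2:ℝ)^l + 2)⁻¹ i) (fun z hz => ?_)
    · rwa [inv_pow, inv_inv] at h1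
    · have hy : ∀ j, (((2:ℝ)^l + 2)⁻¹ • z + cubeNode d ((2:ℝ)^l + 2)⁻¹ i) j =
          ((2:ℝ)^l + 2)⁻¹ * (z j + (i j + 2)) := fun j => by
        simp [cubeNode]; ring
      have := mem_openCube_inter_closedBall (n := 2^l) (by positivity) (x := x)
        (y := ((2:ℝ)^l + 2)⁻¹ • z + cubeNode d ((2:ℝ)^l + 2)⁻¹ i) hi (fun j => ?_) (fun j => ?_)
        (fun j => ?_)
      · simpa using this
      · simpa using mem_Ioo_of_quadSpline_ne_zero (hne j)
      · rw [hy]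
        push_cast
        rw [mul_inv_cancel_left₀ (by positivity)]
        have := hz j
        exact ⟨by linarith [this.1], by linarith [this.2]⟩
      · rw [hy]
        have h3 : -3 < i j := (Finset.mem_Ioo.1 (Fintype.mem_piFinset.1 hi j)).1
        have h4 : (-2:ℝ) ≤ i j := by exact_mod_cast h3
        exact mul_pos hη (by linarith [(hz j).1])

lemma sq_fderiv_sub_quasiInterp_le {d : ℕ} (l : ℕ) {u : EuclideanSpace ℝ (Fin d) → ℝ}
    (hu : ContDiff ℝ 1 u) {x : EuclideanSpace ℝ (Fin d)} (hx : x ∈ openCube d) (m : Fin d) :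
    (fderiv ℝ (fun y => u y - quasiInterp d l u y) x (EuclideanSpace.single m 1))^2 ≤
      8 / (2^l)^2 * (fderiv ℝ u x (EuclideanSpace.single m 1))^2 +
      2 * (((2:ℝ)^l + 2)^d * localOsc d (d * (4 / 2^l))
        (fun y => fderiv ℝ u y (EuclideanSpace.single m 1)) x) := by
  set η := ((2:ℝ)^l + 2)⁻¹ with hηdef
  have hn : (0:ℝ) < 2^l := by positivity
  have hη : 0 < η := by positivity
  have hf : Continuous (fun y => fderiv ℝ u y (EuclideanSpace.single m (1:ℝ))) := by
    have := hu.continuous_fderiv one_ne_zero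
    fun_prop
  set f := fun y => fderiv ℝ u y (EuclideanSpace.single m (1:ℝ)) with hfdef
  have hmvt : ∀ i : Fin d → ℤ, ∃ s ∈ Set.Ioo (0:ℝ) 1,
      cubeAvg d η u (cubeNode d η i) -
        cubeAvg d η u (cubeNode d η (Function.update i m (i m - 1))) =
      η * cubeAvg d η f (cubeNode d η (Function.update i m (i m - 1)) +
        s • η • EuclideanSpace.single m (1:ℝ)) := fun i => by
    obtain ⟨s, hs, h⟩ := exists_cubeAvg_sub_eq hu η
      (cubeNode d η (Function.update i m (i m - 1))) (η • EuclideanSpace.single m (1:ℝ))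
    refine ⟨s, hs, ?_⟩
    rw [cubeNode_update d η i m, h]
    simp only [cubeAvg, map_smul, smul_eq_mul, hfdef, integral_const_mul]
  choose s hs hdiff using hmvt
  have hsum := sq_sum_mul_prod_sub_le
    (φ := fun j k => if j = m then hatSpline (2^l * x j - k) else quadSpline (2^l * x j - k))
    (A := derivIndex d (2^l) m)
    (c := fun i => cubeAvg d η f (cubeNode d η (Function.update i m (i m - 1)) +
        s i • η • EuclideanSpace.single m (1:ℝ))) (v := f x)
    (M := ((2:ℝ)^l + 2)^d * localOsc d (d * (4 / 2^l)) f x) ?_ ?_ ?_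
  · have hprod : ∀ i : Fin d → ℤ,
        ∏ j, (if j = m then hatSpline (2^l * x j - i j) else quadSpline (2^l * x j - i j)) =
        hatSpline (2^l * x m - i m) * ∏ j ∈ Finset.univ.erase m, quadSpline (2^l * x j - i j) :=
      fun i => by
        rw [← Finset.mul_prod_erase _ _ (Finset.mem_univ m), if_pos rfl]
        congr 1
        exact Finset.prod_congr rfl fun j hj => if_neg (Finset.ne_of_mem_erase hj)
    have hderiv : fderiv ℝ (quasiInterp d l u) x (EuclideanSpace.single m 1) =
        2^l * η * ∑ i ∈ Fintype.piFinset (derivIndex d (2^l) m),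
          cubeAvg d η f (cubeNode d η (Function.update i m (i m - 1)) +
            s i • η • EuclideanSpace.single m (1:ℝ)) *
          ∏ j, (if j = m then hatSpline (2^l * x j - i j) else quadSpline (2^l * x j - i j)) := by
      have h1 : HasFDerivAt (quasiInterp d l u)
          (∑ i ∈ Fintype.piFinset (fun _ : Fin d => Finset.Ioo (-3:ℤ) (2^l)),
            cubeAvg d η u (cubeNode d η i) • fderiv ℝ (bsplineMulti d l i) x) x := by
        unfold quasiInterp
        exact HasFDerivAt.fun_sum fun i _ =>
          ((hasFDerivAt_bsplineMulti d l i x).differentiableAt.hasFDerivAt).const_mul _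
      have h2 := sum_mul_sub_hatSpline (n := 2^l) m (two_pow_mul_mem_Ioo l hx m).1
        (two_pow_mul_mem_Ioo l hx m).2 (fun i => cubeAvg d η u (cubeNode d η i))
        (fun i => ∏ j ∈ Finset.univ.erase m, quadSpline (2^l * x j - i j)) (fun i k =>
          Finset.prod_congr rfl fun j hj => by
            rw [Function.update_of_ne (Finset.ne_of_mem_erase hj)])
      push_cast at h2
      rw [h1.fderiv, sum_apply, mul_assoc, Finset.mul_sum]
      simp_rw [smul_apply, fderiv_bsplineMulti_single, smul_eq_mul, mul_left_comm _ ((2:ℝ)^l),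
        ← Finset.mul_sum, h2, hdiff, hprod, Finset.mul_sum, mul_assoc]
    have hfd : fderiv ℝ (fun y => u y - quasiInterp d l u y) x (EuclideanSpace.single m 1) =
        f x - fderiv ℝ (quasiInterp d l u) x (EuclideanSpace.single m 1) := by
      rw [fderiv_fun_sub (hu.differentiable one_ne_zero x) (differentiable_quasiInterp d l u x)]
      rfl
    rw [hfd, hderiv]
    set Q := ∑ i ∈ Fintype.piFinset (derivIndex d (2^l) m),
          cubeAvg d η f (cubeNode d η (Function.update i m (i m - 1)) +
            s i • η • EuclideanSpace.single m (1:ℝ)) *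
          ∏ j, (if j = m then hatSpline (2^l * x j - i j) else quadSpline (2^l * x j - i j)) with hQ
    have hκ : 1 - 2^l * η = 2 * η := by rw [hηdef]; field_simp; ring
    have hκ1 : 2^l * η ≤ 1 := by linarith
    have hη2 : η ≤ 1 / 2^l := by
      rw [le_div_iff₀ hn]; linarith
    have h3 : (f x - 2^l * η * Q)^2 ≤ 2 * (2 * η * f x)^2 + 2 * (2^l * η * (Q - f x))^2 := by
      rw [← hκ]
      nlinarith [sq_nonneg ((1 - 2^l * η) * f x + (2^l * η * (Q - f x)))]
    have h4 : 2 * (2 * η * f x)^2 ≤ 8 / (2^l)^2 * (f x)^2 := by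
      have : η^2 ≤ (1 / 2^l)^2 := pow_le_pow_left₀ hη.le hη2 2
      calc 2 * (2 * η * f x)^2 = 8 * (η^2) * (f x)^2 := by ring
        _ ≤ 8 * (1 / 2^l)^2 * (f x)^2 := by gcongr
        _ = _ := by ring
    have h5 : (2^l * η * (Q - f x))^2 ≤ (Q - f x)^2 := by
      rw [mul_pow]
      exact mul_le_of_le_one_left (sq_nonneg _) (pow_le_one₀ (by positivity) hκ1)
    linarith
  · intro j k
    dsimp only
    split_ifs
    · exact hatSpline_nonneg _
    · exact quadSpline_nonneg _
  · intro j
    unfold derivIndex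
    split_ifs
    · exact sum_hatSpline (two_pow_mul_mem_Ioo l hx j).1 (two_pow_mul_mem_Ioo l hx j).2
    · exact sum_quadSpline (two_pow_mul_mem_Ioo l hx j).1 (two_pow_mul_mem_Ioo l hx j).2
  · intro i hi hne
    have hsi := hs i
    have him : -2 < i m := by
      have := Fintype.mem_piFinset.1 hi m
      rw [derivIndex, if_pos rfl] at this
      exact (Finset.mem_Ioo.1 this).1
    have hi' : i ∈ Fintype.piFinset (fun _ : Fin d => Finset.Ioo (-3:ℤ) ((2^l : ℕ) : ℤ)) := by
      refine Fintype.mem_piFinset.2 fun j => ?_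
      have := Fintype.mem_piFinset.1 hi j
      unfold derivIndex at this
      split_ifs at this
      · exact Finset.Ioo_subset_Ioo_left (by norm_num) this
      · exact this
    have h1 := sq_cubeAvg_sub_le hf hη (r := d * (4 / 2^l)) (x := x)
      (a := cubeNode d η (Function.update i m (i m - 1)) +
        s i • η • EuclideanSpace.single m (1:ℝ)) (fun z hz => ?_)
    · rwa [hηdef, inv_pow, inv_inv] at h1
    · have hy : ∀ j, ∃ τ ∈ Set.Icc (0:ℝ) 1, (τ = 0 ∨ j = m) ∧
          (η • z + (cubeNode d η (Function.update i m (i m - 1)) +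
          s i • η • EuclideanSpace.single m (1:ℝ))) j = η * (z j + (i j + 2) - τ) := fun j => by
        by_cases hj : j = m
        · subst hj
          refine ⟨1 - s i, ⟨by linarith [hsi.2], by linarith [hsi.1]⟩, Or.inr rfl, ?_⟩
          simp [cubeNode]; ring
        · refine ⟨0, ⟨le_rfl, zero_le_one⟩, Or.inl rfl, ?_⟩
          simp [cubeNode, hj]; ring
      have := mem_openCube_inter_closedBall (n := 2^l) (by positivity) (x := x)
        (y := η • z + (cubeNode d η (Function.update i m (i m - 1)) +
          s i • η • EuclideanSpace.single m (1:ℝ))) hi' (fun j => ?_) (fun j => ?_) (fun j => ?_)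
      · simpa using this
      · have h2 := hne j
        dsimp only at h2
        push_cast
        split_ifs at h2
        · exact Set.Ioo_subset_Ioo_right (by norm_num) (mem_Ioo_of_hatSpline_ne_zero h2)
        · exact mem_Ioo_of_quadSpline_ne_zero h2
      · obtain ⟨τ, hτ, -, h⟩ := hy j
        rw [h, hηdef]
        push_cast
        rw [mul_inv_cancel_left₀ (by positivity)]
        have := hz j
        exact ⟨by linarith [this.1, hτ.2], by linarith [this.2, hτ.1]⟩
      · obtain ⟨τ, hτ, h0, h⟩ := hy j
        rw [h]
        refine mul_pos hη ?_
        have := (hz j).1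
        rcases h0 with rfl | rfl
        · have h3 : -3 < i j := (Finset.mem_Ioo.1 (Fintype.mem_piFinset.1 hi' j)).1
          have h4 : (-2:ℝ) ≤ i j := by exact_mod_cast h3
          linarith
        · have h4 : (-1:ℝ) ≤ i j := by exact_mod_cast him
          linarith [hτ.2]

lemma H1normSq_congr {d : ℕ} {u v : EuclideanSpace ℝ (Fin d) → ℝ}
    (h : Set.EqOn u v (openCube d)) : H1normSq d u = H1normSq d v := by
  have ho := isOpen_openCube d
  unfold H1normSq
  congr 1
  · exact setIntegral_congr_fun ho.measurableSet fun x hx => by simp only [h hx]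
  · refine setIntegral_congr_fun ho.measurableSet fun x hx => ?_
    have : u =ᶠ[nhds x] v := h.eventuallyEq_of_mem (ho.mem_nhds hx)
    simp only [gradient, this.fderiv_eq]

lemma H2normSq_congr {d : ℕ} {u v : EuclideanSpace ℝ (Fin d) → ℝ}
    (h : Set.EqOn u v (openCube d)) : H2normSq d u = H2normSq d v := by
  have ho := isOpen_openCube d
  unfold H2normSq
  rw [H1normSq_congr h]
  congr 1
  refine setIntegral_congr_fun ho.measurableSet fun x hx => ?_
  have h1 : u =ᶠ[nhds x] v := h.eventuallyEq_of_mem (ho.mem_nhds hx)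
  have h2 : ∀ w, (fun y => fderiv ℝ u y w) =ᶠ[nhds x] fun y => fderiv ℝ v y w := fun w =>
    h1.fderiv.fun_comp (fun L : EuclideanSpace ℝ (Fin d) →L[ℝ] ℝ => L w)
  simp only [(h2 _).fderiv_eq]

lemma exists_contDiff_eqOn {E : Type*} [NormedAddCommGroup E] [NormedSpace ℝ E]
    [FiniteDimensional ℝ E] {K U : Set E} (hK : IsClosed K) (hU : IsOpen U) (hKU : K ⊆ U)
    {u : E → ℝ} {n : ℕ∞} (hu : ContDiffOn ℝ n u U) : ∃ v, ContDiff ℝ n v ∧ Set.EqOn u v K := by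
  obtain ⟨χ, h0, h1, -⟩ := exists_contMDiffMap_zero_one_nhds_of_isClosed (n := n)
    (modelWithCornersSelf ℝ E) hU.isClosed_compl hK
    (Set.disjoint_left.2 fun x hx hxK => hx (hKU hxK))
  have hχ : ContDiff ℝ n χ := contMDiff_iff_contDiff.1 χ.contMDiff
  refine ⟨fun x => χ x * u x, contDiff_iff_contDiffAt.2 fun x => ?_, fun x hx => ?_⟩
  · by_cases hx : x ∈ U
    · exact hχ.contDiffAt.mul (hu.contDiffAt (hU.mem_nhds hx))
    · have : (fun x => χ x * u x) =ᶠ[nhds x] fun _ => 0 := by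
        filter_upwards [h0.filter_mono (nhds_le_nhdsSet hx)] with y hy
        rw [hy, zero_mul]
      exact contDiffAt_const.congr_of_eventuallyEq this
  · have := (h1.filter_mono (nhds_le_nhdsSet hx)).self_of_nhds
    simp [this]

/-- The H¹ error estimate for the quasi-interpolant of a globally `C²` function. -/
lemma H1normSq_sub_quasiInterp_le (d l : ℕ) {u : EuclideanSpace ℝ (Fin d) → ℝ}
    (hu : ContDiff ℝ 2 u) :
    H1normSq d (fun x => u x - quasiInterp d l u x) ≤
      (2 * (3^d * (4 * d)^(d+2) *
        (volume (Metric.ball (0 : EuclideanSpace ℝ (Fin d)) 1)).toReal) + 8) / (2^l)^2 *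
        H2normSq d u := by
  have hn : (1:ℝ) ≤ 2^l := one_le_pow₀ one_le_two
  have hn0 : (0:ℝ) < 2^l := by positivity
  have hu1 : ContDiff ℝ 1 u := hu.of_le one_le_two
  set V := (volume (Metric.ball (0 : EuclideanSpace ℝ (Fin d)) 1)).toReal
  have hV : 0 ≤ V := ENNReal.toReal_nonneg
  set K := 3^d * (4 * d)^(d+2) * V with hK
  have hK0 : 0 ≤ K := by positivity
  set p : Fin d → EuclideanSpace ℝ (Fin d) → ℝ :=
    fun m y => fderiv ℝ u y (EuclideanSpace.single m (1:ℝ)) with hp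
  have hp1 : ∀ m, ContDiff ℝ 1 (p m) := fun m =>
    (hu.fderiv_right (m := 1) (by norm_num)).clm_apply contDiff_const
  have hosc : ∀ f : EuclideanSpace ℝ (Fin d) → ℝ, ContDiff ℝ 1 f →
      ((2:ℝ)^l + 2)^d * ∫ x in openCube d, localOsc d (d * (4 / 2^l)) f x ≤
        K / (2^l)^2 * ∫ x in openCube d, gradSq d f x := fun f hf => by
    have h1 := (integral_localOsc_le hf (r := d * (4 / 2^l)) (by positivity)).2
    have hG : 0 ≤ ∫ x in openCube d, gradSq d f x := integral_nonneg fun _ => gradSq_nonneg _ _ _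
    calc _ ≤ (3 * 2^l)^d * ((d * (4 / 2^l))^(d+2) * V * ∫ x in openCube d, gradSq d f x) := by
          gcongr
          · exact integral_nonneg fun _ => localOsc_nonneg _ _ _ _
          · linarith
      _ = _ := by
          rw [hK, show (d:ℝ) * (4 / 2^l) = (4 * d) / 2^l by ring, div_pow, mul_pow 3, pow_add (2^l:ℝ)]
          field_simp
  have hL2 : ∫ x in openCube d, (u x - quasiInterp d l u x)^2 ≤
      K / (2^l)^2 * ∫ x in openCube d, gradSq d u x := by
    refine le_trans ?_ (hosc u hu1)
    rw [← integral_const_mul]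
    refine integral_mono_of_nonneg (ae_of_all _ fun _ => sq_nonneg _)
      ((integral_localOsc_le hu1 (by positivity)).1.const_mul _) ?_
    exact (ae_restrict_mem (measurableSet_openCube d)).mono fun x hx =>
      sq_sub_quasiInterp_le l hu.continuous hx
  have hint1 : ∀ m, IntegrableOn (fun x => 8 / (2^l)^2 * (p m x)^2) (openCube d) := fun m =>
    Continuous.integrableOn_openCube (by have := (hp1 m).continuous; fun_prop)
  have hint2 : ∀ m, IntegrableOn (fun x => 2 * (((2:ℝ)^l + 2)^d *
      localOsc d (d * (4 / 2^l)) (p m) x)) (openCube d) := fun m =>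
    ((integral_localOsc_le (hp1 m) (by positivity)).1.const_mul _).const_mul _
  have hint : ∀ m, IntegrableOn (fun x => 8 / (2^l)^2 * (p m x)^2 + 2 * (((2:ℝ)^l + 2)^d *
      localOsc d (d * (4 / 2^l)) (p m) x)) (openCube d) := fun m => (hint1 m).add (hint2 m)
  have hgrad : ∫ x in openCube d, ‖gradient (fun x => u x - quasiInterp d l u x) x‖^2 ≤
      8 / (2^l)^2 * (∫ x in openCube d, gradSq d u x) +
      2 * (K / (2^l)^2 * ∫ x in openCube d, ∑ m, gradSq d (p m) x) := by
    calc _ ≤ ∫ x in openCube d, ∑ m, (8 / (2^l)^2 * (p m x)^2 + 2 * (((2:ℝ)^l + 2)^d *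
            localOsc d (d * (4 / 2^l)) (p m) x)) := by
          refine integral_mono_of_nonneg (ae_of_all _ fun _ => sq_nonneg _)
            (integrable_finsetSum _ fun m _ => hint m) ?_
          refine (ae_restrict_mem (measurableSet_openCube d)).mono fun x hx => ?_
          simp only [norm_gradient_sq, gradSq]
          exact Finset.sum_le_sum fun m _ => sq_fderiv_sub_quasiInterp_le l hu1 hx m
      _ = ∑ m, (8 / (2^l)^2 * (∫ x in openCube d, (p m x)^2) + 2 * (((2:ℝ)^l + 2)^d *
            ∫ x in openCube d, localOsc d (d * (4 / 2^l)) (p m) x)) := by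
          rw [integral_finsetSum _ fun m _ => hint m]
          refine Finset.sum_congr rfl fun m _ => ?_
          rw [integral_add (hint1 m) (hint2 m)]
          simp only [integral_const_mul]
      _ ≤ ∑ m, (8 / (2^l)^2 * (∫ x in openCube d, (p m x)^2) + 2 * (K / (2^l)^2 *
            ∫ x in openCube d, gradSq d (p m) x)) := by
          refine Finset.sum_le_sum fun m _ => ?_
          linarith [hosc _ (hp1 m)]
      _ = _ := by
          rw [Finset.sum_add_distrib, ← Finset.mul_sum, ← Finset.mul_sum, ← Finset.mul_sum,
            integral_finsetSum _ fun m _ => (continuous_gradSq (hp1 m)).integrableOn_openCube]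
          unfold gradSq
          rw [integral_finsetSum _ fun m _ => Continuous.integrableOn_openCube
            (by have := (hp1 m).continuous; fun_prop)]
  have hH2 : H2normSq d u = (∫ x in openCube d, (u x)^2) + (∫ x in openCube d, gradSq d u x) +
      ∫ x in openCube d, ∑ m, gradSq d (p m) x := by
    simp only [H2normSq, H1normSq, norm_gradient_sq]
    rfl
  have hu0 : 0 ≤ ∫ x in openCube d, (u x)^2 := integral_nonneg fun _ => sq_nonneg _
  have hG0 : 0 ≤ ∫ x in openCube d, gradSq d u x := integral_nonneg fun _ => gradSq_nonneg _ _ _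
  have hp0 : 0 ≤ ∫ x in openCube d, ∑ m, gradSq d (p m) x :=
    integral_nonneg fun _ => Finset.sum_nonneg fun _ _ => gradSq_nonneg _ _ _
  rw [H1normSq, hH2]
  refine (add_le_add hL2 hgrad).trans ?_
  rw [div_mul_eq_mul_div, div_mul_eq_mul_div, div_mul_eq_mul_div, div_mul_eq_mul_div,
    ← mul_div_assoc, ← add_div, ← add_div]
  gcongr
  nlinarith [mul_nonneg hK0 hu0, mul_nonneg hK0 hG0, mul_nonneg hK0 hp0]

/-- **B-spline approximation in Sobolev norm (Lemma 3.3).**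
For every `d ≥ 1` there is `C > 0` (depending only on `d`) such that for every
level `l > 2` and every `u` that is `C²` on a neighborhood of `[0,1]^d` there
are coefficients `c_i` (over multi-indices with `−3 < i_j < 2^l`) with
`‖u − Σᵢ cᵢ N_{l,i}‖_{H¹} ≤ (C/2^l)·‖u‖_{H²}`. -/
theorem bspline_approximation (d : ℕ) (hd : 1 ≤ d) :
    ∃ C > (0:ℝ), ∀ l : ℕ, 2 < l →
      ∀ u : EuclideanSpace ℝ (Fin d) → ℝ,
        (∃ U, IsOpen U ∧ closedCube d ⊆ U ∧ ContDiffOn ℝ 2 u U) →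
        ∃ c : (Fin d → ℤ) → ℝ,
          Real.sqrt (H1normSq d
              (u - fun x => ∑ i ∈ Fintype.piFinset (fun _ : Fin d => Finset.Ioo (-3:ℤ) (2^l)),
                c i * bsplineMulti d l i x))
            ≤ C / 2^l * Real.sqrt (H2normSq d u) := by
  refine ⟨Real.sqrt (2 * (3^d * (4 * d)^(d+2) *
    (volume (Metric.ball (0 : EuclideanSpace ℝ (Fin d)) 1)).toReal) + 8), by positivity, ?_⟩
  rintro l - u ⟨U, hU, hcU, hu⟩
  obtain ⟨v, hv, huv⟩ := exists_contDiff_eqOn (n := 2) (isCompact_closedCube d).isClosed hU hcU hu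
  have huv' := huv.mono (openCube_subset_closedCube d)
  refine ⟨fun i => cubeAvg d ((2:ℝ)^l + 2)⁻¹ v (cubeNode d ((2:ℝ)^l + 2)⁻¹ i), ?_⟩
  rw [H1normSq_congr (v := fun x => v x - quasiInterp d l v x) (fun x hx => by
    simp only [Pi.sub_apply, huv' hx, quasiInterp]), H2normSq_congr huv']
  refine (Real.sqrt_le_sqrt (H1normSq_sub_quasiInterp_le d l hv)).trans (le_of_eq ?_)
  rw [Real.sqrt_mul (by positivity), Real.sqrt_div (by positivity), Real.sqrt_sq (by positivity)]
end
end

section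
/- For each d > 1 there exists a constant C > 0 depending only on d such that for every c₂ > 0, every ε > 0, and every function u* that is C² on a neighborhood of [0,1]^d with ‖u*‖_{H²((0,1)^d)} ≤ c₂, there exists a ReLU² network ū : ℝ^d → ℝ with depth at most ⌈log₂ d⌉ + 3 and width at most 4d·⌈C·c₂/ε − 4⌉^d such that ‖u* − ū‖_{H¹((0,1)^d)} ≤ ε. -/
open MeasureTheory

noncomputable section

/-- The `ReLU` activation function `σ₁(t) = max(t,0)`. -/
noncomputable def relu1 (t : ℝ) : ℝ := max t 0

/-- The `ReLU²` activation function `σ₂(t) = max(t,0)²`. -/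
noncomputable def relu2 (t : ℝ) : ℝ := (max t 0) ^ 2

/-- `NNHidden acts m W D k g` : `g : ℝ^m → ℝ^k` is a stack of `D` hidden layers of
widths at most `W`, each layer consisting of an affine map followed by coordinatewise
activations chosen from the set `acts`. -/
inductive NNHidden (acts : Set (ℝ → ℝ)) (m W : ℕ) :
    ℕ → (k : ℕ) → (EuclideanSpace ℝ (Fin m) → (Fin k → ℝ)) → Prop
  | base : NNHidden acts m W 0 m (fun x j => x j)
  | layer {D k k' : ℕ} {g : EuclideanSpace ℝ (Fin m) → Fin k → ℝ}
      (hg : NNHidden acts m W D k g)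
      (A : Matrix (Fin k') (Fin k) ℝ) (b : Fin k' → ℝ) (ρ : Fin k' → ℝ → ℝ)
      (hρ : ∀ j, ρ j ∈ acts) (hk' : k' ≤ W) :
      NNHidden acts m W (D + 1) k' (fun x j => ρ j ((A.mulVec (g x) + b) j))

/-- `IsNetwork acts m D W u` : `u : ℝ^m → ℝ` is implemented by a neural network of
depth `D` (i.e. `D` affine maps and `D − 1` hidden activation layers) and width at
most `W`, whose hidden-unit activations all belong to `acts`. -/
def IsNetwork (acts : Set (ℝ → ℝ)) (m D W : ℕ) (u : EuclideanSpace ℝ (Fin m) → ℝ) : Prop :=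
  ∃ (k : ℕ) (g : EuclideanSpace ℝ (Fin m) → Fin k → ℝ)
    (A : Matrix (Fin 1) (Fin k) ℝ) (b : ℝ),
    NNHidden acts m W (D - 1) k g ∧ ∀ x, u x = A.mulVec (g x) 0 + b

/-- The space of affine combinations of the components of `g`. -/
def affineOutputs {E : Type*} {k : ℕ} (g : E → Fin k → ℝ) : Submodule ℝ (E → ℝ) where
  carrier := {f | ∃ (a : Fin k → ℝ) (b : ℝ), ∀ x, f x = ∑ j, a j * g x j + b}
  zero_mem' := ⟨0, 0, by simp⟩
  add_mem' := by
    rintro f f' ⟨a, b, h⟩ ⟨a', b', h'⟩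
    refine ⟨a + a', b + b', fun x => ?_⟩
    simp only [Pi.add_apply, h, h', add_mul, Finset.sum_add_distrib]
    ring
  smul_mem' := by
    rintro c f ⟨a, b, h⟩
    refine ⟨c • a, c * b, fun x => ?_⟩
    simp only [Pi.smul_apply, smul_eq_mul, h, mul_add, Finset.mul_sum, mul_assoc]

lemma const_mem_affineOutputs {E : Type*} {k : ℕ} (g : E → Fin k → ℝ) (c : ℝ) :
    (fun _ => c) ∈ affineOutputs g := ⟨0, c, by simp⟩

lemma apply_mem_affineOutputs {E : Type*} {k : ℕ} (g : E → Fin k → ℝ) (j : Fin k) :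
    (fun x => g x j) ∈ affineOutputs g := ⟨Pi.single j 1, 0, by simp [Pi.single_apply]⟩

/-- A further `relu2` layer makes the activations of finitely many affine outputs available. -/
lemma NNHidden.exists_relu2_layer {m W D k : ℕ} {g : EuclideanSpace ℝ (Fin m) → Fin k → ℝ}
    (hg : NNHidden {relu2} m W D k g) {ι : Type*} [Fintype ι]
    (f : ι → EuclideanSpace ℝ (Fin m) → ℝ) (hf : ∀ i, f i ∈ affineOutputs g)
    (hι : Fintype.card ι ≤ W) :
    ∃ (k' : ℕ) (g' : EuclideanSpace ℝ (Fin m) → Fin k' → ℝ),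
      NNHidden {relu2} m W (D + 1) k' g' ∧
        ∀ i, (fun x => relu2 (f i x)) ∈ affineOutputs g' := by
  choose a b h using hf
  let e := Fintype.equivFin ι
  refine ⟨_, _, hg.layer (Matrix.of fun j l => a (e.symm j) l) (fun j => b (e.symm j))
    (fun _ => relu2) (by simp) hι, fun i => ?_⟩
  convert apply_mem_affineOutputs _ (e i) using 2 with x
  simp [Matrix.mulVec, dotProduct, h]

lemma relu2_add_relu2_neg (t : ℝ) : relu2 t + relu2 (-t) = t ^ 2 := by
  unfold relu2
  rcases le_total t 0 with h | h
  · rw [max_eq_right h, max_eq_left (by linarith)]; ring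
  · rw [max_eq_left h, max_eq_right (by linarith)]; ring

lemma mul_eq_relu2 (s t : ℝ) :
    s * t = (1 / 4 : ℝ) * (relu2 (s + t) + relu2 (-(s + t)) - (relu2 (s - t) + relu2 (-(s - t)))) := by
  rw [relu2_add_relu2_neg, relu2_add_relu2_neg]; ring

/-- A further `relu2` layer makes finitely many pairwise products available. -/
lemma NNHidden.exists_mul_layer {m W D k : ℕ} {g : EuclideanSpace ℝ (Fin m) → Fin k → ℝ}
    (hg : NNHidden {relu2} m W D k g) {ι : Type*} [Fintype ι]
    (p q : ι → EuclideanSpace ℝ (Fin m) → ℝ) (hp : ∀ i, p i ∈ affineOutputs g)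
    (hq : ∀ i, q i ∈ affineOutputs g) (hι : 4 * Fintype.card ι ≤ W) :
    ∃ (k' : ℕ) (g' : EuclideanSpace ℝ (Fin m) → Fin k' → ℝ),
      NNHidden {relu2} m W (D + 1) k' g' ∧ ∀ i, p i * q i ∈ affineOutputs g' := by
  obtain ⟨k', g', hg', h⟩ := hg.exists_relu2_layer
    (Sum.elim (Sum.elim (fun i => p i + q i) (fun i => -(p i + q i)))
      (Sum.elim (fun i => p i - q i) (fun i => -(p i - q i))))
    (by
      rintro ((i | i) | (i | i))
      · exact add_mem (hp i) (hq i)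
      · exact neg_mem (add_mem (hp i) (hq i))
      · exact sub_mem (hp i) (hq i)
      · exact neg_mem (sub_mem (hp i) (hq i)))
    (by simp only [Fintype.card_sum]; omega)
  refine ⟨k', g', hg', fun i => ?_⟩
  have := (affineOutputs g').smul_mem (1 / 4 : ℝ) (sub_mem
    (add_mem (h (.inl (.inl i))) (h (.inl (.inr i))))
    (add_mem (h (.inr (.inl i))) (h (.inr (.inr i)))))
  convert this using 1
  funext x
  simpa using mul_eq_relu2 (p i x) (q i x)

/-- A binary tree of `L` multiplication layers makes finitely many products of `2 ^ L` factors
available. -/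
lemma NNHidden.exists_prod_layers {m W : ℕ} {ι : Type*} [Fintype ι] (L : ℕ) :
    ∀ {D k : ℕ} {g : EuclideanSpace ℝ (Fin m) → Fin k → ℝ} (_ : NNHidden {relu2} m W D k g)
      (F : ι → ℕ → EuclideanSpace ℝ (Fin m) → ℝ) (_ : ∀ i j, F i j ∈ affineOutputs g)
      (_ : 4 * (Fintype.card ι * 2 ^ L) ≤ W),
    ∃ (k' : ℕ) (g' : EuclideanSpace ℝ (Fin m) → Fin k' → ℝ),
      NNHidden {relu2} m W (D + L) k' g' ∧
        ∀ i, ∏ j ∈ Finset.range (2 ^ L), F i j ∈ affineOutputs g' := by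
  induction L with
  | zero =>
    intro D k g hg F hF _
    exact ⟨k, g, hg, fun i => by simpa using hF i 0⟩
  | succ L ih =>
    intro D k g hg F hF hW
    have hle : 2 ^ L ≤ 2 ^ (L + 1) := Nat.pow_le_pow_right (by norm_num) (by omega)
    have hW' : 4 * (Fintype.card ι * 2 ^ L) ≤ W :=
      le_trans (by gcongr) hW
    obtain ⟨k₁, g₁, hg₁, h₁⟩ := hg.exists_mul_layer (ι := ι × Fin (2 ^ L))
      (fun i => F i.1 i.2) (fun i => F i.1 (2 ^ L + i.2)) (fun _ => hF _ _) (fun _ => hF _ _)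
      (by simpa using hW')
    obtain ⟨k₂, g₂, hg₂, h₂⟩ := ih hg₁
      (fun i j => if j < 2 ^ L then F i j * F i (2 ^ L + j) else 0)
      (fun i j => by
        split_ifs with hj
        · exact h₁ (i, ⟨j, hj⟩)
        · exact zero_mem _) hW'
    refine ⟨k₂, g₂, by rwa [add_assoc, add_comm 1 L] at hg₂, fun i => ?_⟩
    convert h₂ i using 1
    rw [pow_succ, mul_two, Finset.prod_range_add, ← Finset.prod_mul_distrib]
    exact Finset.prod_congr rfl fun j hj => by rw [if_pos (Finset.mem_range.1 hj)]

lemma NNHidden.isNetwork {acts : Set (ℝ → ℝ)} {m W D k : ℕ}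
    {g : EuclideanSpace ℝ (Fin m) → Fin k → ℝ} (hg : NNHidden acts m W D k g)
    {u : EuclideanSpace ℝ (Fin m) → ℝ} (hu : u ∈ affineOutputs g) :
    IsNetwork acts m (D + 1) W u := by
  obtain ⟨a, b, h⟩ := hu
  exact ⟨k, g, Matrix.of fun _ j => a j, b, hg, fun x => by
    simp [h, Matrix.mulVec, dotProduct]⟩

section Poincare

open Module

open scoped ENNReal

lemma sq_intervalIntegral_le {h : ℝ → ℝ} (hh : ContinuousOn h (Set.Icc 0 1)) :
    (∫ t in (0 : ℝ)..1, h t) ^ 2 ≤ ∫ t in (0 : ℝ)..1, h t ^ 2 := by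
  set c := ∫ t in (0 : ℝ)..1, h t with hc
  have hh' : ContinuousOn h (Set.uIcc 0 1) := by rwa [Set.uIcc_of_le zero_le_one]
  have i₁ : IntervalIntegrable h volume 0 1 := hh'.intervalIntegrable
  have i₂ : IntervalIntegrable (fun t => h t ^ 2) volume 0 1 := (hh'.pow 2).intervalIntegrable
  have : 0 ≤ ∫ t in (0 : ℝ)..1, (h t ^ 2 - 2 * c * h t + c ^ 2) :=
    intervalIntegral.integral_nonneg zero_le_one fun t _ => by nlinarith [sq_nonneg (h t - c)]
  rw [intervalIntegral.integral_add (i₂.sub (i₁.const_mul _)) (by simp),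
    intervalIntegral.integral_sub i₂ (i₁.const_mul _), intervalIntegral.integral_const_mul,
    ← hc] at this
  simp at this
  nlinarith

lemma ofReal_sub_sq_le_lintegral_segment {E : Type*} [NormedAddCommGroup E] [NormedSpace ℝ E]
    {K U : Set E} (hK : Convex ℝ K) (hU : IsOpen U)
    (hKU : K ⊆ U) {f : E → ℝ} (hf : ContDiffOn ℝ 1 f U) {δ : ℝ}
    {x y : E} (hx : x ∈ K) (hy : y ∈ K) (hxy : ‖x - y‖ ≤ δ) :
    ENNReal.ofReal ((f x - f y) ^ 2) ≤ ENNReal.ofReal (δ ^ 2) *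
      ∫⁻ t in Set.Icc (0 : ℝ) 1, ENNReal.ofReal (‖fderiv ℝ f (y + t • (x - y))‖ ^ 2) := by
  have hδ : 0 ≤ δ := (norm_nonneg _).trans hxy
  have hseg : ∀ t ∈ Set.Icc (0 : ℝ) 1, y + t • (x - y) ∈ U := fun t ht =>
    hKU (hK.add_smul_sub_mem hy hx ht)
  have hcont : ContinuousOn (fun t : ℝ => fderiv ℝ f (y + t • (x - y))) (Set.Icc 0 1) :=
    (hf.continuousOn_fderiv_of_isOpen hU le_rfl).comp (by fun_prop) hseg
  have hderiv : ∀ t ∈ Set.uIcc (0 : ℝ) 1,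
      HasDerivAt (fun t : ℝ => f (y + t • (x - y))) (fderiv ℝ f (y + t • (x - y)) (x - y)) t := by
    intro t ht
    rw [Set.uIcc_of_le zero_le_one] at ht
    have h₁ : HasFDerivAt f (fderiv ℝ f (y + t • (x - y))) (y + t • (x - y)) :=
      ((hf.differentiableOn one_ne_zero).differentiableAt (hU.mem_nhds (hseg t ht))).hasFDerivAt
    have h₂ : HasDerivAt (fun t : ℝ => y + t • (x - y)) (x - y) t := by
      simpa using ((hasDerivAt_id t).smul_const (x - y)).const_add y
    exact h₁.comp_hasDerivAt t h₂
  have hcont' : ContinuousOn (fun t : ℝ => fderiv ℝ f (y + t • (x - y)) (x - y))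
      (Set.Icc 0 1) := hcont.clm_apply continuousOn_const
  have hFTC := intervalIntegral.integral_eq_sub_of_hasDerivAt hderiv
    (by rw [← Set.uIcc_of_le zero_le_one] at hcont'; exact hcont'.intervalIntegrable)
  simp only [one_smul, add_sub_cancel, zero_smul, add_zero] at hFTC
  have hint : IntegrableOn (fun t : ℝ => ‖fderiv ℝ f (y + t • (x - y))‖ ^ 2) (Set.Icc 0 1) :=
    (hcont.norm.pow 2).integrableOn_Icc
  rw [← ofReal_integral_eq_lintegral_ofReal hint (by filter_upwards with t; positivity),
    ← ENNReal.ofReal_mul (by positivity)]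
  apply ENNReal.ofReal_le_ofReal
  rw [← hFTC]
  refine (sq_intervalIntegral_le hcont').trans ?_
  rw [intervalIntegral.integral_of_le zero_le_one, ← integral_Icc_eq_integral_Ioc,
    ← integral_const_mul]
  refine integral_mono (hcont'.pow 2).integrableOn_Icc (hint.const_mul _) fun t => ?_
  calc (fderiv ℝ f (y + t • (x - y)) (x - y)) ^ 2
      = ‖fderiv ℝ f (y + t • (x - y)) (x - y)‖ ^ 2 := by simp
    _ ≤ (‖fderiv ℝ f (y + t • (x - y))‖ * δ) ^ 2 := by
        gcongr
        exact (ContinuousLinearMap.le_opNorm _ _).trans (by gcongr)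
    _ = _ := by ring

variable {E : Type*} [NormedAddCommGroup E] [NormedSpace ℝ E] [FiniteDimensional ℝ E]
  [MeasurableSpace E] [BorelSpace E] (μ : Measure E) [μ.IsAddHaarMeasure]

lemma lintegral_comp_add_smul_sub {g : E → ℝ≥0∞} (hg : Measurable g) (y : E) {t : ℝ}
    (ht : t ≠ 0) :
    ∫⁻ x, g (y + t • (x - y)) ∂μ = ENNReal.ofReal |(t ^ finrank ℝ E)⁻¹| * ∫⁻ x, g x ∂μ := by
  have h₁ : ∫⁻ x, g (y + t • (x - y)) ∂μ = ∫⁻ x, g (y + t • x) ∂μ := by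
    simpa using lintegral_sub_right_eq_self (μ := μ) (fun x => g (y + t • x)) y
  have h₂ : ∫⁻ x, g (y + t • x) ∂μ = ∫⁻ x, g (y + x) ∂(μ.map (t • ·)) := by
    rw [lintegral_map (by fun_prop) (by fun_prop)]
  rw [h₁, h₂, Measure.map_addHaar_smul μ ht, lintegral_smul_measure,
    lintegral_add_left_eq_self g y, smul_eq_mul]

lemma setLIntegral_comp_add_smul_sub_le {K : Set E} (hK : Convex ℝ K) (hKm : MeasurableSet K)
    {g : E → ℝ≥0∞} (hg : Measurable g) {y : E} (hy : y ∈ K) {t : ℝ}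
    (ht : t ∈ Set.Icc (1 / 2 : ℝ) 1) :
    ∫⁻ x in K, g (y + t • (x - y)) ∂μ ≤ 2 ^ finrank ℝ E * ∫⁻ x in K, g x ∂μ := by
  have ht₀ : 0 < t := by linarith [ht.1]
  calc ∫⁻ x in K, g (y + t • (x - y)) ∂μ
      = ∫⁻ x, K.indicator (fun x => g (y + t • (x - y))) x ∂μ := (lintegral_indicator hKm _).symm
    _ ≤ ∫⁻ x, K.indicator g (y + t • (x - y)) ∂μ := by
        refine lintegral_mono fun x => ?_
        by_cases hx : x ∈ K
        · rw [Set.indicator_of_mem hx, Set.indicator_of_mem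
            (hK.add_smul_sub_mem hy hx ⟨ht₀.le, ht.2⟩)]
        · simp [hx]
    _ = ENNReal.ofReal |(t ^ finrank ℝ E)⁻¹| * ∫⁻ x in K, g x ∂μ := by
        rw [lintegral_comp_add_smul_sub μ (hg.indicator hKm) y ht₀.ne', lintegral_indicator hKm]
    _ ≤ 2 ^ finrank ℝ E * ∫⁻ x in K, g x ∂μ := by
        gcongr
        rw [abs_of_pos (by positivity), ← inv_pow, ENNReal.ofReal_pow (by positivity)]
        gcongr
        rw [ENNReal.ofReal_le_iff_le_toReal (by simp)]
        rw [inv_le_comm₀ ht₀ (by simp)]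
        simpa using ht.1

lemma lintegral_lintegral_comp_add_smul_sub_le {K : Set E} (hK : Convex ℝ K)
    (hKm : MeasurableSet K) {g : E → ℝ≥0∞} (hg : Measurable g) {t : ℝ}
    (ht : t ∈ Set.Icc (0 : ℝ) 1) :
    ∫⁻ y in K, ∫⁻ x in K, g (y + t • (x - y)) ∂μ ∂μ
      ≤ 2 ^ finrank ℝ E * (∫⁻ x in K, g x ∂μ) * μ K := by
  have key : ∀ {s : ℝ}, s ∈ Set.Icc (1 / 2 : ℝ) 1 →
      ∫⁻ y in K, ∫⁻ x in K, g (y + s • (x - y)) ∂μ ∂μ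
        ≤ 2 ^ finrank ℝ E * (∫⁻ x in K, g x ∂μ) * μ K := fun {s} hs =>
    calc _ ≤ ∫⁻ _ in K, 2 ^ finrank ℝ E * (∫⁻ x in K, g x ∂μ) ∂μ :=
          setLIntegral_mono measurable_const fun y hy =>
            setLIntegral_comp_add_smul_sub_le μ hK hKm hg hy hs
      _ = _ := by rw [setLIntegral_const]
  rcases le_total (1 / 2) t with h | h
  · exact key ⟨h, ht.2⟩
  · rw [lintegral_lintegral_swap (by fun_prop)]
    convert key (s := 1 - t) ⟨by linarith, by linarith [ht.1]⟩ using 6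
    module

/-- For a convex set `K`, the average of `g` over segments from some base point of `K` to the
points of `K` is controlled by the integral of `g` over `K`. -/
lemma exists_lintegral_segment_le {K : Set E} (hK : Convex ℝ K)
    (hKm : MeasurableSet K) (h₀ : μ K ≠ 0) (h₁ : μ K ≠ ∞) {g : E → ℝ≥0∞} (hg : Measurable g) :
    ∃ y ∈ K, ∫⁻ x in K, (∫⁻ t in Set.Icc (0 : ℝ) 1, g (y + t • (x - y))) ∂μ
      ≤ 2 ^ finrank ℝ E * ∫⁻ x in K, g x ∂μ := by
  have hmeas : Measurable fun p : E × E => ∫⁻ t in Set.Icc (0 : ℝ) 1, g (p.1 + t • (p.2 - p.1)) :=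
    Measurable.lintegral_prod_right' (f := fun q : (E × E) × ℝ =>
      g (q.1.1 + q.2 • (q.1.2 - q.1.1))) (by fun_prop)
  obtain ⟨y, hy, h⟩ := exists_le_setLAverage (μ := μ) (s := K)
    (f := fun y => ∫⁻ x in K, (∫⁻ t in Set.Icc (0 : ℝ) 1, g (y + t • (x - y))) ∂μ) h₀ h₁
    hmeas.lintegral_prod_right'.aemeasurable
  refine ⟨y, hy, h.trans ?_⟩
  rw [setLAverage_eq]
  refine ENNReal.div_le_of_le_mul ?_
  have swap : ∀ y : E, ∫⁻ x in K, (∫⁻ t in Set.Icc (0 : ℝ) 1, g (y + t • (x - y))) ∂μ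
      = ∫⁻ t in Set.Icc (0 : ℝ) 1, ∫⁻ x in K, g (y + t • (x - y)) ∂μ := fun y =>
    lintegral_lintegral_swap (by fun_prop)
  have hmeas' : Measurable fun p : E × ℝ => ∫⁻ x in K, g (p.1 + p.2 • (x - p.1)) ∂μ :=
    Measurable.lintegral_prod_right' (f := fun q : (E × ℝ) × E =>
      g (q.1.1 + q.1.2 • (q.2 - q.1.1))) (by fun_prop)
  simp_rw [swap]
  rw [lintegral_lintegral_swap hmeas'.aemeasurable]
  calc _ ≤ ∫⁻ _ in Set.Icc (0 : ℝ) 1, 2 ^ finrank ℝ E * (∫⁻ x in K, g x ∂μ) * μ K :=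
        setLIntegral_mono measurable_const fun t ht =>
          lintegral_lintegral_comp_add_smul_sub_le μ hK hKm hg ht
    _ = _ := by simp

/-- **Poincaré inequality** on a convex set of diameter at most `δ`. -/
lemma exists_lintegral_sub_const_sq_le {K U : Set E} (hK : Convex ℝ K) (hKm : MeasurableSet K)
    (h₁ : μ K ≠ ∞) (hU : IsOpen U) (hKU : K ⊆ U) {f : E → ℝ} (hf : ContDiffOn ℝ 1 f U) {δ : ℝ}
    (hδ : ∀ x ∈ K, ∀ y ∈ K, ‖x - y‖ ≤ δ) :
    ∃ c : ℝ, ∫⁻ x in K, ENNReal.ofReal ((f x - c) ^ 2) ∂μ ≤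
      ENNReal.ofReal (2 ^ finrank ℝ E * δ ^ 2) *
        ∫⁻ x in K, ENNReal.ofReal (‖fderiv ℝ f x‖ ^ 2) ∂μ := by
  by_cases h₀ : μ K = 0
  · exact ⟨0, by simp [setLIntegral_measure_zero _ _ h₀]⟩
  have hm : Measurable fun x => ENNReal.ofReal (‖fderiv ℝ f x‖ ^ 2) :=
    ((measurable_fderiv ℝ f).norm.pow_const 2).ennreal_ofReal
  obtain ⟨y, hy, h⟩ := exists_lintegral_segment_le μ hK hKm h₀ h₁ hm
  refine ⟨f y, ?_⟩
  calc _ ≤ ∫⁻ x in K, ENNReal.ofReal (δ ^ 2) * (∫⁻ t in Set.Icc (0 : ℝ) 1,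
          ENNReal.ofReal (‖fderiv ℝ f (y + t • (x - y))‖ ^ 2)) ∂μ :=
        setLIntegral_mono' hKm fun x hx =>
          ofReal_sub_sq_le_lintegral_segment hK hU hKU hf hx hy (hδ x hx y hy)
    _ = ENNReal.ofReal (δ ^ 2) * ∫⁻ x in K, (∫⁻ t in Set.Icc (0 : ℝ) 1,
          ENNReal.ofReal (‖fderiv ℝ f (y + t • (x - y))‖ ^ 2)) ∂μ :=
        lintegral_const_mul' _ _ (by simp)
    _ ≤ ENNReal.ofReal (δ ^ 2) * (2 ^ finrank ℝ E *
          ∫⁻ x in K, ENNReal.ofReal (‖fderiv ℝ f x‖ ^ 2) ∂μ) := by gcongr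
    _ = _ := by
        rw [ENNReal.ofReal_mul (by positivity), ENNReal.ofReal_pow (p := 2) (by norm_num),
          ENNReal.ofReal_ofNat]
        ring

end Poincare

/-- The `C¹` piecewise quadratic step from `0` (for `t ≤ 0`) to `1` (for `t ≥ 1`). -/
def smoothStep (t : ℝ) : ℝ := 2 * relu2 t - 4 * relu2 (t - 1 / 2) + 2 * relu2 (t - 1)

/-- The derivative of `smoothStep`. -/
def smoothStepDeriv (t : ℝ) : ℝ := 4 * max t 0 - 8 * max (t - 1 / 2) 0 + 4 * max (t - 1) 0

lemma hasDerivAt_relu2 (t : ℝ) : HasDerivAt relu2 (2 * max t 0) t := by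
  rcases lt_trichotomy t 0 with h | rfl | h
  · rw [max_eq_right h.le, mul_zero]
    refine (hasDerivAt_const t (0 : ℝ)).congr_of_eventuallyEq ?_
    filter_upwards [gt_mem_nhds h] with s hs
    simp [relu2, max_eq_right hs.le]
  · simp only [max_self, mul_zero]
    rw [hasDerivAt_iff_isLittleO_nhds_zero]
    simp only [zero_add, relu2, max_self, smul_zero, sub_zero, ne_eq, OfNat.ofNat_ne_zero,
      not_false_eq_true, zero_pow]
    refine Asymptotics.IsBigO.trans_isLittleO (g := fun h : ℝ => h ^ 2) ?_ ?_
    · refine Asymptotics.isBigO_of_le _ fun s => ?_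
      simp only [norm_pow, Real.norm_eq_abs]
      refine pow_le_pow_left₀ (abs_nonneg _) ?_ 2
      rcases le_total s 0 with hs | hs
      · rw [max_eq_right hs, abs_zero]
        exact abs_nonneg s
      · rw [max_eq_left hs]
    · simpa using Asymptotics.isLittleO_pow_id (𝕜 := ℝ) one_lt_two
  · rw [max_eq_left h.le]
    refine HasDerivAt.congr_of_eventuallyEq (f := fun s => s ^ 2) ?_ ?_
    · simpa using hasDerivAt_pow 2 t
    · filter_upwards [lt_mem_nhds h] with s hs
      simp [relu2, max_eq_left hs.le]

lemma hasDerivAt_smoothStep (t : ℝ) : HasDerivAt smoothStep (smoothStepDeriv t) t := by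
  have h (c : ℝ) : HasDerivAt (fun s => relu2 (s - c)) (2 * max (t - c) 0) t :=
    (hasDerivAt_relu2 (t - c)).comp_sub_const t c
  refine ((((hasDerivAt_relu2 t).const_mul 2).sub ((h (1 / 2)).const_mul 4)).add
    ((h 1).const_mul 2)).congr_deriv ?_
  rw [smoothStepDeriv]
  ring

lemma smoothStep_of_nonpos {t : ℝ} (h : t ≤ 0) : smoothStep t = 0 := by
  rw [smoothStep, relu2, relu2, relu2, max_eq_right h, max_eq_right (by linarith),
    max_eq_right (by linarith)]
  ring

lemma smoothStep_of_one_le {t : ℝ} (h : 1 ≤ t) : smoothStep t = 1 := by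
  rw [smoothStep, relu2, relu2, relu2, max_eq_left (by linarith), max_eq_left (by linarith),
    max_eq_left (by linarith)]
  ring

lemma smoothStepDeriv_of_nonpos {t : ℝ} (h : t ≤ 0) : smoothStepDeriv t = 0 := by
  rw [smoothStepDeriv, max_eq_right h, max_eq_right (by linarith), max_eq_right (by linarith)]
  ring

lemma smoothStepDeriv_of_one_le {t : ℝ} (h : 1 ≤ t) : smoothStepDeriv t = 0 := by
  rw [smoothStepDeriv, max_eq_left (by linarith), max_eq_left (by linarith),
    max_eq_left (by linarith)]
  ring

lemma smoothStep_mem_Icc (t : ℝ) : smoothStep t ∈ Set.Icc (0 : ℝ) 1 := by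
  simp only [smoothStep, relu2, max_def, Set.mem_Icc]
  split_ifs <;> constructor <;> nlinarith

lemma smoothStepDeriv_mem_Icc (t : ℝ) : smoothStepDeriv t ∈ Set.Icc (0 : ℝ) 2 := by
  simp only [smoothStepDeriv, max_def, Set.mem_Icc]
  split_ifs <;> constructor <;> linarith

/-- A `C¹` bump function supported in `[-1, 1]` whose integer translates sum to one. -/
def bump (t : ℝ) : ℝ := smoothStep (t + 1) - smoothStep t

/-- The derivative of `bump`. -/
def bumpDeriv (t : ℝ) : ℝ := smoothStepDeriv (t + 1) - smoothStepDeriv t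

lemma hasDerivAt_bump (t : ℝ) : HasDerivAt bump (bumpDeriv t) t :=
  ((hasDerivAt_smoothStep (t + 1)).comp_add_const t 1).sub (hasDerivAt_smoothStep t)

lemma abs_bump_le (t : ℝ) : |bump t| ≤ 1 := by
  have h₁ := smoothStep_mem_Icc (t + 1)
  have h₂ := smoothStep_mem_Icc t
  exact abs_le.2 ⟨by unfold bump; linarith [h₁.1, h₂.2], by unfold bump; linarith [h₁.2, h₂.1]⟩

lemma abs_bumpDeriv_le (t : ℝ) : |bumpDeriv t| ≤ 2 := by
  have h₁ := smoothStepDeriv_mem_Icc (t + 1)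
  have h₂ := smoothStepDeriv_mem_Icc t
  exact abs_le.2
    ⟨by unfold bumpDeriv; linarith [h₁.1, h₂.2], by unfold bumpDeriv; linarith [h₁.2, h₂.1]⟩

lemma bump_of_one_le_abs {t : ℝ} (h : 1 ≤ |t|) : bump t = 0 := by
  rcases le_abs'.1 h with h | h
  · rw [bump, smoothStep_of_nonpos (by linarith), smoothStep_of_nonpos (by linarith), sub_zero]
  · rw [bump, smoothStep_of_one_le (by linarith), smoothStep_of_one_le h, sub_self]

lemma bumpDeriv_of_one_le_abs {t : ℝ} (h : 1 ≤ |t|) : bumpDeriv t = 0 := by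
  rcases le_abs'.1 h with h | h
  · rw [bumpDeriv, smoothStepDeriv_of_nonpos (by linarith),
      smoothStepDeriv_of_nonpos (by linarith), sub_zero]
  · rw [bumpDeriv, smoothStepDeriv_of_one_le (by linarith), smoothStepDeriv_of_one_le h, sub_self]

lemma sum_bump_eq_one {N : ℕ} {t : ℝ} (ht : t ∈ Set.Icc (0 : ℝ) N) :
    ∑ k : Fin (N + 1), bump (t - (k : ℕ)) = 1 := by
  have h := Finset.sum_range_sub' (fun k : ℕ => smoothStep (t + 1 - k)) (N + 1)
  rw [Nat.cast_zero, smoothStep_of_one_le (by linarith [ht.1]),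
    smoothStep_of_nonpos (by push_cast; linarith [ht.2]), sub_zero] at h
  rw [← h, Finset.sum_range]
  refine Finset.sum_congr rfl fun k _ => ?_
  rw [bump]
  push_cast
  congr 2 <;> ring

/-- The tensor product bump centred at the grid point `i / N`. -/
def tensorBump {d N : ℕ} (i : Fin d → Fin (N + 1)) (x : EuclideanSpace ℝ (Fin d)) : ℝ :=
  ∏ j, bump (N * x j - (i j : ℕ))

/-- The part of the open unit cube on which `tensorBump i` lives. -/
def gridPatch {d N : ℕ} (i : Fin d → Fin (N + 1)) : Set (EuclideanSpace ℝ (Fin d)) :=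
  {x | x ∈ openCube d ∧ ∀ j, |N * x j - (i j : ℕ)| < 1}

lemma gridPatch_subset_openCube {d N : ℕ} (i : Fin d → Fin (N + 1)) :
    gridPatch i ⊆ openCube d := fun _ hx => hx.1

lemma convex_gridPatch {d N : ℕ} (i : Fin d → Fin (N + 1)) : Convex ℝ (gridPatch i) := by
  intro x hx y hy a b ha hb hab
  have hb' : b = 1 - a := by linarith
  refine ⟨fun j => ?_, fun j => ?_⟩
  · exact convex_Ioo 0 1 (hx.1 j) (hy.1 j) ha hb hab
  · have h := convex_Ioo (-1 : ℝ) 1 (abs_lt.1 (hx.2 j)) (abs_lt.1 (hy.2 j)) ha hb hab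
    rw [abs_lt]
    rw [Set.mem_Ioo] at h
    convert h using 2 <;>
    · simp only [PiLp.add_apply, PiLp.smul_apply, smul_eq_mul, hb']
      ring

lemma measurableSet_gridPatch {d N : ℕ} (i : Fin d → Fin (N + 1)) :
    MeasurableSet (gridPatch i) := by
  refine ((isOpen_openCube d).inter (t := {x | ∀ j, |(N : ℝ) * x j - (i j : ℕ)| < 1}) ?_).measurableSet
  simp only [Set.ofPred_forall]
  exact isOpen_iInter_of_finite fun j => isOpen_lt (by fun_prop) continuous_const

lemma norm_sub_le_of_mem_gridPatch {d N : ℕ} (hN : 0 < N) (i : Fin d → Fin (N + 1))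
    {x y : EuclideanSpace ℝ (Fin d)} (hx : x ∈ gridPatch i) (hy : y ∈ gridPatch i) :
    ‖x - y‖ ≤ √d * (2 / N) := by
  have hN' : (0 : ℝ) < N := by exact_mod_cast hN
  rw [EuclideanSpace.norm_eq]
  refine Real.sqrt_le_iff.2 ⟨by positivity, ?_⟩
  rw [mul_pow, Real.sq_sqrt (by positivity)]
  calc ∑ j, ‖(x - y) j‖ ^ 2 ≤ ∑ _j : Fin d, (2 / N : ℝ) ^ 2 := by
        refine Finset.sum_le_sum fun j _ => ?_
        gcongr
        have h₁ := abs_lt.1 (hx.2 j)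
        have h₂ := abs_lt.1 (hy.2 j)
        rw [PiLp.sub_apply, Real.norm_eq_abs, abs_le, ← neg_div, div_le_iff₀ hN', le_div_iff₀ hN']
        constructor <;> nlinarith
    _ = _ := by simp

lemma card_gridPatch_le {d N : ℕ} (x : EuclideanSpace ℝ (Fin d)) :
    (Finset.univ.filter fun i : Fin d → Fin (N + 1) =>
      ∀ j, |N * x j - (i j : ℕ)| < 1).card ≤ 2 ^ d := by
  have h₁ (t : ℝ) : (Finset.univ.filter fun k : Fin (N + 1) => |t - (k : ℕ)| < 1).card ≤ 2 := by
    refine (Finset.card_le_card_of_injOn (fun k : Fin (N + 1) => ((k : ℕ) : ℤ))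
      (t := ({⌊t⌋, ⌊t⌋ + 1} : Finset ℤ)) ?_ ?_).trans Finset.card_le_two
    · intro k hk
      have hk := abs_lt.1 (Finset.mem_filter.1 hk).2
      have h₁ : ⌊t⌋ < ((k : ℕ) : ℤ) + 1 := Int.floor_lt.2 (by push_cast; linarith)
      have h₂ : ((k : ℕ) : ℤ) - 1 ≤ ⌊t⌋ := Int.le_floor.2 (by push_cast; linarith)
      simp only [Finset.coe_insert, Finset.coe_singleton, Set.mem_insert_iff,
        Set.mem_singleton_iff]
      omega
    · intro k _ l _ h
      exact Fin.ext (Int.ofNat_inj.1 h)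
  have h₂ : (Finset.univ.filter fun i : Fin d → Fin (N + 1) => ∀ j, |N * x j - (i j : ℕ)| < 1)
      = Fintype.piFinset fun j => Finset.univ.filter fun k : Fin (N + 1) =>
        |N * x j - (k : ℕ)| < 1 := by
    ext i
    simp
  rw [h₂, Fintype.card_piFinset]
  exact (Finset.prod_le_prod' fun j _ => h₁ (N * x j)).trans (by simp)

lemma sum_tensorBump {d N : ℕ} {x : EuclideanSpace ℝ (Fin d)} (hx : x ∈ closedCube d) :
    ∑ i : Fin d → Fin (N + 1), tensorBump i x = 1 := by
  simp only [tensorBump]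
  rw [← Fintype.piFinset_univ, ← Finset.prod_univ_sum (fun _ => Finset.univ)
    (fun j (k : Fin (N + 1)) => bump (N * x j - (k : ℕ)))]
  refine Finset.prod_eq_one fun j _ => sum_bump_eq_one ⟨?_, ?_⟩
  · exact mul_nonneg N.cast_nonneg (hx j).1
  · exact mul_le_of_le_one_right N.cast_nonneg (hx j).2

lemma abs_tensorBump_le {d N : ℕ} (i : Fin d → Fin (N + 1)) (x : EuclideanSpace ℝ (Fin d)) :
    |tensorBump i x| ≤ 1 := by
  rw [tensorBump, Finset.abs_prod]
  exact Finset.prod_le_one (fun _ _ => abs_nonneg _) fun _ _ => abs_bump_le _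

/-- The derivative of `tensorBump`. -/
def tensorBumpDeriv {d N : ℕ} (i : Fin d → Fin (N + 1)) (x : EuclideanSpace ℝ (Fin d)) :
    EuclideanSpace ℝ (Fin d) →L[ℝ] ℝ :=
  ∑ j, (∏ l ∈ Finset.univ.erase j, bump (N * x l - (i l : ℕ))) •
    (bumpDeriv (N * x j - (i j : ℕ)) * N) • EuclideanSpace.proj j

lemma hasFDerivAt_tensorBump {d N : ℕ} (i : Fin d → Fin (N + 1))
    (x : EuclideanSpace ℝ (Fin d)) :
    HasFDerivAt (tensorBump i) (tensorBumpDeriv i x) x := by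
  refine HasFDerivAt.finsetProd fun j _ => ?_
  have h : HasFDerivAt (fun x : EuclideanSpace ℝ (Fin d) => (N : ℝ) * x j - (i j : ℕ))
      ((N : ℝ) • EuclideanSpace.proj j : EuclideanSpace ℝ (Fin d) →L[ℝ] ℝ) x :=
    ((EuclideanSpace.proj (𝕜 := ℝ) j).hasFDerivAt.const_mul (N : ℝ)).sub_const _
  rw [mul_smul]
  exact (hasDerivAt_bump _).comp_hasFDerivAt x h

lemma norm_tensorBumpDeriv_le {d N : ℕ} (i : Fin d → Fin (N + 1))
    (x : EuclideanSpace ℝ (Fin d)) : ‖tensorBumpDeriv i x‖ ≤ 2 * d * N := by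
  have h (j : Fin d) : ‖(EuclideanSpace.proj j : EuclideanSpace ℝ (Fin d) →L[ℝ] ℝ)‖ ≤ 1 :=
    ContinuousLinearMap.opNorm_le_bound _ zero_le_one fun y => by
      simpa using PiLp.norm_apply_le y j
  calc ‖tensorBumpDeriv i x‖ ≤ ∑ _j : Fin d, (1 * (2 * N * 1) : ℝ) := by
        refine norm_sum_le_of_le _ fun j _ => ?_
        rw [norm_smul, norm_smul, norm_mul, Real.norm_natCast, Real.norm_eq_abs,
          Real.norm_eq_abs, Finset.abs_prod]
        gcongr
        · exact Finset.prod_le_one (fun _ _ => abs_nonneg _) fun _ _ => abs_bump_le _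
        · exact abs_bumpDeriv_le _
        · exact h j
    _ = _ := by simp; ring

lemma tensorBump_of_notMem {d N : ℕ} {i : Fin d → Fin (N + 1)} {x : EuclideanSpace ℝ (Fin d)}
    (hx : ¬ ∀ j, |N * x j - (i j : ℕ)| < 1) : tensorBump i x = 0 := by
  push Not at hx
  obtain ⟨j, hj⟩ := hx
  exact Finset.prod_eq_zero (Finset.mem_univ j) (bump_of_one_le_abs hj)

lemma tensorBumpDeriv_of_notMem {d N : ℕ} {i : Fin d → Fin (N + 1)}
    {x : EuclideanSpace ℝ (Fin d)} (hx : ¬ ∀ j, |N * x j - (i j : ℕ)| < 1) :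
    tensorBumpDeriv i x = 0 := by
  push Not at hx
  obtain ⟨j, hj⟩ := hx
  refine Finset.sum_eq_zero fun l _ => ?_
  rcases eq_or_ne l j with rfl | h
  · rw [bumpDeriv_of_one_le_abs hj, zero_mul, zero_smul, smul_zero]
  · rw [Finset.prod_eq_zero (Finset.mem_erase.2 ⟨h.symm, Finset.mem_univ j⟩)
      (bump_of_one_le_abs hj), zero_smul]

lemma integral_le_of_lintegral_ofReal_le {α : Type*} [MeasurableSpace α] {μ : Measure α}
    {h : α → ℝ} (hh : ∀ x, 0 ≤ h x) {r : ℝ} (hr : 0 ≤ r)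
    (hle : ∫⁻ x, ENNReal.ofReal (h x) ∂μ ≤ ENNReal.ofReal r) : ∫ x, h x ∂μ ≤ r := by
  by_cases hm : AEStronglyMeasurable h μ
  · rw [integral_eq_lintegral_of_nonneg_ae (Filter.Eventually.of_forall hh) hm]
    exact ENNReal.toReal_le_of_le_ofReal hr hle
  · rwa [integral_undef fun hi => hm hi.aestronglyMeasurable]

lemma norm_sum_sq_le_card_mul_sum {ι V : Type*} [NormedAddCommGroup V] (s : Finset ι)
    (v : ι → V) : ‖∑ i ∈ s, v i‖ ^ 2 ≤ s.card * ∑ i ∈ s, ‖v i‖ ^ 2 :=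
  (pow_le_pow_left₀ (norm_nonneg _) (norm_sum_le _ _) 2).trans (sq_sum_le_card_mul_sum_sq)

open Classical in
lemma setLIntegral_norm_sum_sq_le {α ι V : Type*} [MeasurableSpace α] {μ : Measure α} [Fintype ι]
    [NormedAddCommGroup V] {Q : Set α} {K : ι → Set α} (hQ : MeasurableSet Q)
    (hK : ∀ i, MeasurableSet (K i)) (hKQ : ∀ i, K i ⊆ Q) {M : ℕ}
    (hM : ∀ x ∈ Q, (Finset.univ.filter fun i => x ∈ K i).card ≤ M) {v : ι → α → V}
    (hv : ∀ i, ∀ x ∈ Q, x ∉ K i → v i x = 0) {c : ι → α → ℝ}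
    (hc : ∀ i x, ‖v i x‖ ^ 2 ≤ c i x) (hcm : ∀ i, AEMeasurable (c i) (μ.restrict Q)) :
    ∫⁻ x in Q, ENNReal.ofReal (‖∑ i, v i x‖ ^ 2) ∂μ
      ≤ M * ∑ i, ∫⁻ x in K i, ENNReal.ofReal (c i x) ∂μ := by
  calc ∫⁻ x in Q, ENNReal.ofReal (‖∑ i, v i x‖ ^ 2) ∂μ
      ≤ ∫⁻ x in Q, M * ∑ i, (K i).indicator (fun x => ENNReal.ofReal (c i x)) x ∂μ := by
        refine setLIntegral_mono' hQ fun x hx => ?_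
        have h₁ : ∑ i, v i x = ∑ i with x ∈ K i, v i x := by
          rw [Finset.sum_filter]
          refine Finset.sum_congr rfl fun i _ => ?_
          split_ifs with h
          · rfl
          · exact hv i x hx h
        have h₂ : ∑ i, (K i).indicator (fun x => ENNReal.ofReal (c i x)) x
            = ENNReal.ofReal (∑ i with x ∈ K i, c i x) := by
          rw [ENNReal.ofReal_sum_of_nonneg fun i _ => (sq_nonneg _).trans (hc i x),
            Finset.sum_filter]
          exact Finset.sum_congr rfl fun i _ => Set.indicator_apply _ _ _
        rw [h₁, h₂, ← ENNReal.ofReal_natCast, ← ENNReal.ofReal_mul (by positivity)]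
        refine ENNReal.ofReal_le_ofReal ((norm_sum_sq_le_card_mul_sum _ _).trans ?_)
        gcongr
        · exact hM x hx
        · exact hc _ x
    _ = M * ∑ i, ∫⁻ x in K i, ENNReal.ofReal (c i x) ∂μ := by
        rw [lintegral_const_mul' _ _ (by simp), lintegral_finsetSum' _ fun i _ =>
          (hcm i).ennreal_ofReal.indicator (hK i)]
        congr 1
        refine Finset.sum_congr rfl fun i _ => ?_
        rw [lintegral_indicator (hK i), Measure.restrict_restrict (hK i),
          Set.inter_eq_left.2 (hKQ i)]

open Classical in
lemma sum_setLIntegral_le {α ι : Type*} [MeasurableSpace α] {μ : Measure α} [Fintype ι]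
    {Q : Set α} {K : ι → Set α} (hQ : MeasurableSet Q)
    (hK : ∀ i, MeasurableSet (K i)) (hKQ : ∀ i, K i ⊆ Q) {M : ℕ}
    (hM : ∀ x ∈ Q, (Finset.univ.filter fun i => x ∈ K i).card ≤ M) {h : α → ENNReal}
    (hh : Measurable h) :
    ∑ i, ∫⁻ x in K i, h x ∂μ ≤ M * ∫⁻ x in Q, h x ∂μ := by
  calc ∑ i, ∫⁻ x in K i, h x ∂μ = ∫⁻ x in Q, ∑ i, (K i).indicator h x ∂μ := by
        rw [lintegral_finsetSum _ fun i _ => hh.indicator (hK i)]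
        refine Finset.sum_congr rfl fun i _ => ?_
        rw [lintegral_indicator (hK i), Measure.restrict_restrict (hK i),
          Set.inter_eq_left.2 (hKQ i)]
    _ ≤ ∫⁻ x in Q, M * h x ∂μ := by
        refine setLIntegral_mono' hQ fun x hx => ?_
        simp only [Set.indicator_apply]
        rw [← Finset.sum_filter, Finset.sum_const, nsmul_eq_mul]
        gcongr
        exact hM x hx
    _ = _ := lintegral_const_mul' _ _ (by simp)

lemma norm_sq_eq_sum_apply_single {d : ℕ} (L : EuclideanSpace ℝ (Fin d) →L[ℝ] ℝ) :
    ‖L‖ ^ 2 = ∑ k, L (EuclideanSpace.single k 1) ^ 2 := by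
  have h := EuclideanSpace.norm_sq_eq ((InnerProductSpace.toDual ℝ _).symm L)
  rw [LinearIsometryEquiv.norm_map] at h
  rw [h]
  refine Finset.sum_congr rfl fun k _ => ?_
  rw [← InnerProductSpace.toDual_symm_apply (x := EuclideanSpace.single k 1) (y := L),
    EuclideanSpace.inner_single_right]
  simp

lemma norm_gradient_eq {d : ℕ} (u : EuclideanSpace ℝ (Fin d) → ℝ) (x : EuclideanSpace ℝ (Fin d)) :
    ‖gradient u x‖ = ‖fderiv ℝ u x‖ := by
  rw [gradient, LinearIsometryEquiv.norm_map]

/-- The sum of the squares of all second partial derivatives. -/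
def hessianSq {d : ℕ} (u : EuclideanSpace ℝ (Fin d) → ℝ) (x : EuclideanSpace ℝ (Fin d)) : ℝ :=
  ∑ i, ∑ j, (fderiv ℝ (fun y => fderiv ℝ u y (EuclideanSpace.single i 1)) x
      (EuclideanSpace.single j 1))^2

lemma hessianSq_nonneg {d : ℕ} (u : EuclideanSpace ℝ (Fin d) → ℝ)
    (x : EuclideanSpace ℝ (Fin d)) : 0 ≤ hessianSq u x := by
  unfold hessianSq; positivity

lemma measurable_hessianSq {d : ℕ} (u : EuclideanSpace ℝ (Fin d) → ℝ) :
    Measurable (hessianSq u) :=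
  Finset.measurable_sum _ fun _ _ => Finset.measurable_sum _ fun _ _ =>
    (measurable_fderiv_apply_const ℝ _ _).pow_const 2

/-- The affine function with linear part `a` and constant part `b`. -/
def affineFun {d : ℕ} (a : Fin d → ℝ) (b : ℝ) (x : EuclideanSpace ℝ (Fin d)) : ℝ :=
  ∑ k, a k * x k + b

/-- The derivative of `affineFun a b`. -/
def affineFunDeriv {d : ℕ} (a : Fin d → ℝ) : EuclideanSpace ℝ (Fin d) →L[ℝ] ℝ :=
  ∑ k, a k • EuclideanSpace.proj k

lemma hasFDerivAt_affineFun {d : ℕ} (a : Fin d → ℝ) (b : ℝ) (x : EuclideanSpace ℝ (Fin d)) :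
    HasFDerivAt (affineFun a b) (affineFunDeriv a) x :=
  (HasFDerivAt.fun_sum fun k _ =>
    (EuclideanSpace.proj (𝕜 := ℝ) k).hasFDerivAt.const_mul (a k)).add_const b

lemma affineFunDeriv_single {d : ℕ} (a : Fin d → ℝ) (k : Fin d) :
    affineFunDeriv a (EuclideanSpace.single k 1) = a k := by
  simp [affineFunDeriv]

/-- On a convex set of small diameter, a `C²` function is approximated by an affine function. -/
lemma exists_affineFun_approx {d : ℕ} {K U : Set (EuclideanSpace ℝ (Fin d))} (hK : Convex ℝ K)
    (hKm : MeasurableSet K) (h₁ : volume K ≠ ⊤) (hU : IsOpen U) (hKU : K ⊆ U)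
    {u : EuclideanSpace ℝ (Fin d) → ℝ} (hu : ContDiffOn ℝ 2 u U) {δ : ℝ}
    (hδ : ∀ x ∈ K, ∀ y ∈ K, ‖x - y‖ ≤ δ) :
    ∃ (a : Fin d → ℝ) (b : ℝ),
      ∫⁻ x in K, ENNReal.ofReal (‖fderiv ℝ u x - affineFunDeriv a‖ ^ 2) ≤
        ENNReal.ofReal (2 ^ d * δ ^ 2) * ∫⁻ x in K, ENNReal.ofReal (hessianSq u x) ∧
      ∫⁻ x in K, ENNReal.ofReal ((u x - affineFun a b x) ^ 2) ≤
        ENNReal.ofReal (2 ^ d * δ ^ 2) *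
          ∫⁻ x in K, ENNReal.ofReal (‖fderiv ℝ u x - affineFunDeriv a‖ ^ 2) := by
  have hu' : ∀ k, ContDiffOn ℝ 1 (fun y => fderiv ℝ u y (EuclideanSpace.single k 1)) U :=
    fun k => (hu.fderiv_of_isOpen hU (by norm_num)).clm_apply contDiffOn_const
  choose a ha using fun k => exists_lintegral_sub_const_sq_le volume hK hKm h₁ hU hKU (hu' k) hδ
  obtain ⟨b, hb⟩ := exists_lintegral_sub_const_sq_le volume hK hKm h₁ hU hKU
    (f := fun x => u x - affineFun a 0 x)
    ((hu.of_le (by norm_num)).sub (by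
      unfold affineFun
      exact ContDiff.contDiffOn (by fun_prop))) hδ
  rw [finrank_euclideanSpace_fin] at hb
  simp only [finrank_euclideanSpace_fin] at ha
  refine ⟨a, b, ?_, ?_⟩
  · calc ∫⁻ x in K, ENNReal.ofReal (‖fderiv ℝ u x - affineFunDeriv a‖ ^ 2)
        = ∑ k, ∫⁻ x in K,
            ENNReal.ofReal ((fderiv ℝ u x (EuclideanSpace.single k 1) - a k) ^ 2) := by
          rw [← lintegral_finsetSum _ fun k _ =>
            (((measurable_fderiv_apply_const ℝ _ _).sub_const _).pow_const 2).ennreal_ofReal]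
          refine lintegral_congr fun x => ?_
          rw [norm_sq_eq_sum_apply_single, ENNReal.ofReal_sum_of_nonneg fun _ _ => sq_nonneg _]
          simp [affineFunDeriv_single]
      _ ≤ ∑ k, ENNReal.ofReal (2 ^ d * δ ^ 2) * ∫⁻ x in K, ENNReal.ofReal
            (‖fderiv ℝ (fun y => fderiv ℝ u y (EuclideanSpace.single k 1)) x‖ ^ 2) :=
          Finset.sum_le_sum fun k _ => ha k
      _ = _ := by
          rw [← Finset.mul_sum, ← lintegral_finsetSum _ fun k _ =>
            ((measurable_fderiv ℝ _).norm.pow_const 2).ennreal_ofReal]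
          congr 1
          refine lintegral_congr fun x => ?_
          rw [← ENNReal.ofReal_sum_of_nonneg fun _ _ => sq_nonneg _]
          simp only [norm_sq_eq_sum_apply_single, hessianSq]
  · refine (le_of_eq ?_).trans (hb.trans (le_of_eq ?_))
    · refine lintegral_congr fun x => ?_
      simp only [affineFun]
      ring_nf
    · congr 1
      refine setLIntegral_congr_fun hKm fun x hx => ?_
      have h : HasFDerivAt u (fderiv ℝ u x) x :=
        ((hu.differentiableOn two_ne_zero).differentiableAt
          (hU.mem_nhds (hKU hx))).hasFDerivAt
      simp only [(h.fun_sub (hasFDerivAt_affineFun a 0 x)).fderiv]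

/-- The affine functions `affineFun (a i) (b i)` glued together by the tensor bumps. -/
def glue {d N : ℕ} (a : (Fin d → Fin (N + 1)) → Fin d → ℝ) (b : (Fin d → Fin (N + 1)) → ℝ)
    (x : EuclideanSpace ℝ (Fin d)) : ℝ :=
  ∑ i, tensorBump i x * affineFun (a i) (b i) x

lemma sub_glue_eq {d N : ℕ} (a : (Fin d → Fin (N + 1)) → Fin d → ℝ)
    (b : (Fin d → Fin (N + 1)) → ℝ) (u : EuclideanSpace ℝ (Fin d) → ℝ)
    {x : EuclideanSpace ℝ (Fin d)} (hx : x ∈ openCube d) :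
    (u - glue a b) x = ∑ i, tensorBump i x * (u x - affineFun (a i) (b i) x) := by
  simp only [Pi.sub_apply, glue, mul_sub, Finset.sum_sub_distrib]
  rw [← Finset.sum_mul, sum_tensorBump (openCube_subset_closedCube d hx), one_mul]

lemma fderiv_sub_glue_eq {d N : ℕ} (a : (Fin d → Fin (N + 1)) → Fin d → ℝ)
    (b : (Fin d → Fin (N + 1)) → ℝ) {u : EuclideanSpace ℝ (Fin d) → ℝ}
    {x : EuclideanSpace ℝ (Fin d)} (hx : x ∈ openCube d) (hu : DifferentiableAt ℝ u x) :
    fderiv ℝ (u - glue a b) x = ∑ i, (tensorBump i x • (fderiv ℝ u x - affineFunDeriv (a i))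
      + (u x - affineFun (a i) (b i) x) • tensorBumpDeriv i x) := by
  have h : HasFDerivAt
      (fun y => ∑ i, tensorBump i y * (u y - affineFun (a i) (b i) y))
      (∑ i, (tensorBump i x • (fderiv ℝ u x - affineFunDeriv (a i))
        + (u x - affineFun (a i) (b i) x) • tensorBumpDeriv i x)) x :=
    HasFDerivAt.fun_sum fun i _ => (hasFDerivAt_tensorBump i x).mul
      (hu.hasFDerivAt.fun_sub (hasFDerivAt_affineFun (a i) (b i) x))
  refine (h.congr_of_eventuallyEq ?_).fderiv
  filter_upwards [(isOpen_openCube d).mem_nhds hx] with y hy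
  exact sub_glue_eq a b u hy

lemma volume_openCube_ne_top (d : ℕ) : volume (openCube d) ≠ ⊤ :=
  ((measure_mono (openCube_subset_closedCube d)).trans_lt
    (isCompact_closedCube d).measure_lt_top).ne

open Classical in
lemma card_mem_gridPatch_le {d N : ℕ} (x : EuclideanSpace ℝ (Fin d)) :
    (Finset.univ.filter fun i : Fin d → Fin (N + 1) => x ∈ gridPatch i).card ≤ 2 ^ d := by
  refine (Finset.card_le_card fun i hi => ?_).trans (card_gridPatch_le (N := N) x)
  exact Finset.mem_filter.2 ⟨Finset.mem_univ _, (Finset.mem_filter.1 hi).2.2⟩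

lemma integrableOn_hessianSq {d : ℕ} {U : Set (EuclideanSpace ℝ (Fin d))} (hU : IsOpen U)
    (hQU : closedCube d ⊆ U) {u : EuclideanSpace ℝ (Fin d) → ℝ} (hu : ContDiffOn ℝ 2 u U) :
    IntegrableOn (hessianSq u) (openCube d) := by
  have hcont : ContinuousOn (hessianSq u) U :=
    continuousOn_finsetSum _ fun i _ => continuousOn_finsetSum _ fun j _ =>
      ((((hu.fderiv_of_isOpen (m := 1) hU (by norm_num)).clm_apply
        contDiffOn_const).continuousOn_fderiv_of_isOpen hU le_rfl).clm_apply
          continuousOn_const).pow 2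
  exact ((hcont.mono hQU).integrableOn_compact (isCompact_closedCube d)).mono_set
    (openCube_subset_closedCube d)

/-- The squared constant in the `H¹` error estimate for `glue`. -/
def glueConst (d : ℕ) : ℝ :=
  4 ^ d * ((2 ^ d * (d * 4)) ^ 2 + (2 * (2 ^ d * (d * 4)) + 8 * d ^ 2 * (2 ^ d * (d * 4)) ^ 2))

/-- Gluing suitable affine functions on a grid with `N` cells in each direction approximates
every `C²` function in `H¹` with error of order `1 / N`. -/
lemma exists_H1normSq_sub_glue_le {d N : ℕ} (hN : 0 < N) {U : Set (EuclideanSpace ℝ (Fin d))}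
    (hU : IsOpen U) (hQU : closedCube d ⊆ U) {u : EuclideanSpace ℝ (Fin d) → ℝ}
    (hu : ContDiffOn ℝ 2 u U) :
    ∃ (a : (Fin d → Fin (N + 1)) → Fin d → ℝ) (b : (Fin d → Fin (N + 1)) → ℝ),
      H1normSq d (u - glue a b) ≤
        glueConst d / (N : ℝ) ^ 2 * ∫ x in openCube d, hessianSq u x := by
  have hN' : (0 : ℝ) < N := by exact_mod_cast hN
  have hN₁ : (1 : ℝ) ≤ N := by exact_mod_cast hN
  have hQU' : openCube d ⊆ U := (openCube_subset_closedCube d).trans hQU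
  have hQm : MeasurableSet (openCube d) := (isOpen_openCube d).measurableSet
  obtain ⟨κ, hκ⟩ : ∃ κ : ℝ, κ = 2 ^ d * (√d * (2 / N)) ^ 2 := ⟨_, rfl⟩
  have hκ₀ : 0 ≤ κ := by rw [hκ]; positivity
  choose a b ha hb using fun i : Fin d → Fin (N + 1) =>
    exists_affineFun_approx (convex_gridPatch i) (measurableSet_gridPatch i)
      (measure_ne_top_of_subset (gridPatch_subset_openCube i) (volume_openCube_ne_top d)) hU
      ((gridPatch_subset_openCube i).trans hQU') hu
      fun x hx y hy => norm_sub_le_of_mem_gridPatch hN i hx hy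
  simp only [← hκ] at ha hb
  refine ⟨a, b, ?_⟩
  set H : ENNReal := ∫⁻ x in openCube d, ENNReal.ofReal (hessianSq u x) with hH
  have hH' : H = ENNReal.ofReal (∫ x in openCube d, hessianSq u x) :=
    (ofReal_integral_eq_lintegral_ofReal (integrableOn_hessianSq hU hQU hu)
      (Filter.Eventually.of_forall (hessianSq_nonneg u))).symm
  have hI₀ : 0 ≤ ∫ x in openCube d, hessianSq u x := integral_nonneg (hessianSq_nonneg u)
  have hsum : ∑ i : Fin d → Fin (N + 1), ∫⁻ x in gridPatch i, ENNReal.ofReal (hessianSq u x)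
      ≤ (2 ^ d : ℕ) * H :=
    sum_setLIntegral_le hQm measurableSet_gridPatch gridPatch_subset_openCube
      (fun x _ => card_mem_gridPatch_le x) (measurable_hessianSq u).ennreal_ofReal
  have hfm : ∀ i, AEMeasurable (fun x => (u x - affineFun (a i) (b i) x) ^ 2)
      (volume.restrict (openCube d)) := fun i => by
    refine ContinuousOn.aemeasurable ?_ hQm
    refine (ContinuousOn.sub (hu.continuousOn.mono hQU') ?_).pow 2
    unfold affineFun
    exact Continuous.continuousOn (by fun_prop)
  have hgm : ∀ i, Measurable (fun x => ‖fderiv ℝ u x - affineFunDeriv (a i)‖ ^ 2) := fun i =>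
    ((measurable_fderiv ℝ u).sub_const _).norm.pow_const 2
  have hb' : ∀ i, ∫⁻ x in gridPatch i, ENNReal.ofReal ((u x - affineFun (a i) (b i) x) ^ 2)
      ≤ ENNReal.ofReal (κ ^ 2) * ∫⁻ x in gridPatch i, ENNReal.ofReal (hessianSq u x) := fun i => by
    refine (hb i).trans ?_
    rw [sq κ, ENNReal.ofReal_mul hκ₀, mul_assoc]
    exact mul_le_mul_right (ha i) _
  have hnot : ∀ (i : Fin d → Fin (N + 1)), ∀ x ∈ openCube d, x ∉ gridPatch i →
      ¬ ∀ j, |N * x j - (i j : ℕ)| < 1 := fun i x hx hxi h => hxi ⟨hx, h⟩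
  have e₁ : ∫ x in openCube d, ((u - glue a b) x) ^ 2
      ≤ 4 ^ d * κ ^ 2 * ∫ x in openCube d, hessianSq u x := by
    refine integral_le_of_lintegral_ofReal_le (fun _ => sq_nonneg _) (by positivity) ?_
    calc ∫⁻ x in openCube d, ENNReal.ofReal (((u - glue a b) x) ^ 2)
        = ∫⁻ x in openCube d, ENNReal.ofReal
            (‖∑ i, tensorBump i x * (u x - affineFun (a i) (b i) x)‖ ^ 2) :=
          setLIntegral_congr_fun hQm fun x hx => by
            simp only [sub_glue_eq a b u hx, Real.norm_eq_abs, sq_abs]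
      _ ≤ (2 ^ d : ℕ) * ∑ i, ∫⁻ x in gridPatch i,
            ENNReal.ofReal ((u x - affineFun (a i) (b i) x) ^ 2) := by
          refine setLIntegral_norm_sum_sq_le hQm measurableSet_gridPatch
            gridPatch_subset_openCube (fun x _ => card_mem_gridPatch_le x) ?_ ?_ hfm
          · intro i x hx hxi
            rw [tensorBump_of_notMem (hnot i x hx hxi), zero_mul]
          · intro i x
            rw [norm_mul, mul_pow, Real.norm_eq_abs, Real.norm_eq_abs, sq_abs (u x - _)]
            exact mul_le_of_le_one_left (sq_nonneg _)
              (pow_le_one₀ (abs_nonneg _) (abs_tensorBump_le i x))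
      _ ≤ (2 ^ d : ℕ) * (ENNReal.ofReal (κ ^ 2) * ((2 ^ d : ℕ) * H)) := by
          gcongr
          refine (Finset.sum_le_sum fun i _ => hb' i).trans ?_
          rw [← Finset.mul_sum]
          gcongr
      _ = _ := by
          rw [hH', ← ENNReal.ofReal_natCast, ← ENNReal.ofReal_mul (by positivity),
            ← ENNReal.ofReal_mul (by positivity), ← ENNReal.ofReal_mul (by positivity)]
          congr 1
          rw [show (4 : ℝ) ^ d = 2 ^ d * 2 ^ d by rw [← mul_pow]; norm_num]
          push_cast
          ring
  have e₂ : ∫ x in openCube d, ‖gradient (u - glue a b) x‖ ^ 2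
      ≤ 4 ^ d * (2 * κ + 2 * (2 * d * N) ^ 2 * κ ^ 2) * ∫ x in openCube d, hessianSq u x := by
    refine integral_le_of_lintegral_ofReal_le (fun _ => sq_nonneg _) (by positivity) ?_
    calc ∫⁻ x in openCube d, ENNReal.ofReal (‖gradient (u - glue a b) x‖ ^ 2)
        = ∫⁻ x in openCube d, ENNReal.ofReal
            (‖∑ i, (tensorBump i x • (fderiv ℝ u x - affineFunDeriv (a i))
              + (u x - affineFun (a i) (b i) x) • tensorBumpDeriv i x)‖ ^ 2) :=
          setLIntegral_congr_fun hQm fun x hx => by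
            simp only [norm_gradient_eq]
            rw [fderiv_sub_glue_eq a b hx ((hu.differentiableOn two_ne_zero).differentiableAt
              (hU.mem_nhds (hQU' hx)))]
      _ ≤ (2 ^ d : ℕ) * ∑ i, ∫⁻ x in gridPatch i,
            ENNReal.ofReal (2 * ‖fderiv ℝ u x - affineFunDeriv (a i)‖ ^ 2
              + 2 * (2 * d * N) ^ 2 * (u x - affineFun (a i) (b i) x) ^ 2) := by
          refine setLIntegral_norm_sum_sq_le hQm measurableSet_gridPatch
            gridPatch_subset_openCube (fun x _ => card_mem_gridPatch_le x) ?_ ?_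
            fun i => ((hgm i).aemeasurable.const_mul _).add ((hfm i).const_mul _)
          · intro i x hx hxi
            rw [tensorBump_of_notMem (hnot i x hx hxi), tensorBumpDeriv_of_notMem
              (hnot i x hx hxi), zero_smul, smul_zero, add_zero]
          · intro i x
            set f := u x - affineFun (a i) (b i) x
            set g := ‖fderiv ℝ u x - affineFunDeriv (a i)‖ with hg
            have h₁ : ‖tensorBump i x • (fderiv ℝ u x - affineFunDeriv (a i))
                + f • tensorBumpDeriv i x‖ ≤ g + |f| * (2 * d * N) := by
              refine (norm_add_le _ _).trans ?_
              rw [norm_smul, norm_smul, Real.norm_eq_abs, Real.norm_eq_abs]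
              refine add_le_add (mul_le_of_le_one_left (norm_nonneg _) (abs_tensorBump_le i x)) ?_
              gcongr
              exact norm_tensorBumpDeriv_le i x
            calc _ ≤ (g + |f| * (2 * d * N)) ^ 2 := by gcongr
              _ ≤ 2 * (g ^ 2 + (|f| * (2 * d * N)) ^ 2) := add_sq_le
              _ = _ := by rw [mul_pow, sq_abs]; ring
      _ = (2 ^ d : ℕ) * ∑ i,
            (2 * (∫⁻ x in gridPatch i,
              ENNReal.ofReal (‖fderiv ℝ u x - affineFunDeriv (a i)‖ ^ 2))
            + ENNReal.ofReal (2 * (2 * d * N) ^ 2) * ∫⁻ x in gridPatch i,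
              ENNReal.ofReal ((u x - affineFun (a i) (b i) x) ^ 2)) := by
          congr 1
          refine Finset.sum_congr rfl fun i _ => ?_
          rw [← lintegral_const_mul' _ _ (by simp), ← lintegral_const_mul' _ _ ENNReal.ofReal_ne_top,
            ← lintegral_add_left ((hgm i).ennreal_ofReal.const_mul 2)]
          refine lintegral_congr fun x => ?_
          rw [ENNReal.ofReal_add (by positivity) (by positivity), ENNReal.ofReal_mul (by norm_num),
            ENNReal.ofReal_mul (by positivity), ENNReal.ofReal_ofNat]
      _ ≤ (2 ^ d : ℕ) * ∑ i : Fin d → Fin (N + 1), ((ENNReal.ofReal 2 * ENNReal.ofReal κ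
            + ENNReal.ofReal (2 * (2 * d * N) ^ 2) * ENNReal.ofReal (κ ^ 2))
              * ∫⁻ x in gridPatch i, ENNReal.ofReal (hessianSq u x)) := by
          refine mul_le_mul_right (Finset.sum_le_sum fun i _ => ?_) _
          rw [add_mul, mul_assoc (ENNReal.ofReal 2), mul_assoc (ENNReal.ofReal (2 * (2 * d * N) ^ 2)),
            ENNReal.ofReal_ofNat]
          exact add_le_add (mul_le_mul_right (ha i) _) (mul_le_mul_right (hb' i) _)
      _ ≤ (2 ^ d : ℕ) * ((ENNReal.ofReal 2 * ENNReal.ofReal κ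
            + ENNReal.ofReal (2 * (2 * d * N) ^ 2) * ENNReal.ofReal (κ ^ 2))
              * ((2 ^ d : ℕ) * H)) := by
          rw [← Finset.mul_sum]
          gcongr
      _ = _ := by
          rw [hH', ← ENNReal.ofReal_natCast, ← ENNReal.ofReal_mul (by positivity),
            ← ENNReal.ofReal_mul (by positivity), ← ENNReal.ofReal_mul (by positivity),
            ← ENNReal.ofReal_add (by positivity) (by positivity),
            ← ENNReal.ofReal_mul (by positivity), ← ENNReal.ofReal_mul (by positivity)]
          congr 1
          rw [show (4 : ℝ) ^ d = 2 ^ d * 2 ^ d by rw [← mul_pow]; norm_num]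
          push_cast
          ring
  refine (add_le_add e₁ e₂).trans ?_
  rw [← add_mul]
  refine mul_le_mul_of_nonneg_right ?_ hI₀
  set k : ℝ := 2 ^ d * (d * 4) with hk
  have hκk : κ = k / (N : ℝ) ^ 2 := by
    rw [hκ, hk, mul_pow, Real.sq_sqrt (by positivity), div_pow]
    ring
  have hκ₂ : κ ^ 2 ≤ k ^ 2 / (N : ℝ) ^ 2 := by
    rw [hκk, div_pow]
    exact div_le_div_of_nonneg_left (sq_nonneg k) (by positivity)
      (le_self_pow₀ (one_le_pow₀ hN₁) two_ne_zero)
  have hlast : 2 * (2 * d * N) ^ 2 * κ ^ 2 = 8 * d ^ 2 * k ^ 2 / (N : ℝ) ^ 2 := by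
    rw [hκk]
    field_simp
    ring
  rw [hlast, glueConst, ← hk, ← mul_add, mul_div_assoc ((4 : ℝ) ^ d), add_div, add_div]
  refine mul_le_mul_of_nonneg_left (add_le_add hκ₂ (le_of_eq ?_)) (by positivity)
  rw [hκk, mul_div_assoc 2 k]

/-- Glued affine functions are `relu2` networks: the first hidden layer provides the univariate
bumps and the affine functions, the others multiply them. -/
lemma isNetwork_glue {d N W : ℕ} (hd : 1 < d) (a : (Fin d → Fin (N + 1)) → Fin d → ℝ)
    (b : (Fin d → Fin (N + 1)) → ℝ) (hW₁ : d * ((N + 2) * 3) + d * 4 ≤ W)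
    (hW₂ : 4 * ((N + 1) ^ d * 2 ^ (Nat.clog 2 d + 1)) ≤ W) :
    IsNetwork {relu2} d (Nat.clog 2 d + 3) W (glue a b) := by
  have hcoord (j : Fin d) : (fun x : EuclideanSpace ℝ (Fin d) => x j) ∈
      affineOutputs (fun (x : EuclideanSpace ℝ (Fin d)) (j : Fin d) => x j) :=
    apply_mem_affineOutputs _ j
  have hconst (c : ℝ) : (fun _ : EuclideanSpace ℝ (Fin d) => c) ∈
      affineOutputs (fun (x : EuclideanSpace ℝ (Fin d)) (j : Fin d) => x j) :=
    const_mem_affineOutputs _ c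
  obtain ⟨k, g, hg, h⟩ := (NNHidden.base (acts := {relu2}) (m := d) (W := W)).exists_relu2_layer
    (ι := Fin d × Fin (N + 2) × Fin 3 ⊕ Fin d × Fin 4)
    (Sum.elim
      (fun p x => N * x p.1 + (1 - (p.2.1 : ℕ) - ![0, 1 / 2, 1] p.2.2))
      (fun p x => ![1, -1, 1, -1] p.2 * x p.1 + ![1, -1, -1, 1] p.2))
    (by
      rintro (p | p)
      · exact add_mem (Submodule.smul_mem _ _ (hcoord p.1)) (hconst _)
      · exact add_mem (Submodule.smul_mem _ _ (hcoord p.1)) (hconst _))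
    (by simpa using hW₁)
  have hstep (j : Fin d) (l : Fin (N + 2)) :
      (fun x : EuclideanSpace ℝ (Fin d) => smoothStep (N * x j + (1 - (l : ℕ)))) ∈
        affineOutputs g := by
    have := add_mem (sub_mem ((affineOutputs g).smul_mem 2 (h (.inl (j, l, 0))))
      ((affineOutputs g).smul_mem 4 (h (.inl (j, l, 1)))))
      ((affineOutputs g).smul_mem 2 (h (.inl (j, l, 2))))
    convert this using 1
    funext x
    simp [smoothStep, add_sub_assoc]
  have hbump (j : Fin d) (l : Fin (N + 1)) :
      (fun x : EuclideanSpace ℝ (Fin d) => bump (N * x j - (l : ℕ))) ∈ affineOutputs g := by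
    convert sub_mem (hstep j l.castSucc) (hstep j l.succ) using 1
    funext x
    simp only [bump, Pi.sub_apply, Fin.val_castSucc, Fin.val_succ]
    push_cast
    congr 2 <;> ring
  have hx (j : Fin d) : (fun x : EuclideanSpace ℝ (Fin d) => x j) ∈ affineOutputs g := by
    have := (affineOutputs g).smul_mem (1 / 4 : ℝ) (sub_mem
      (add_mem (h (.inr (j, 0))) (h (.inr (j, 1)))) (add_mem (h (.inr (j, 2))) (h (.inr (j, 3)))))
    convert this using 1
    funext x
    have := mul_eq_relu2 (x j) 1
    rw [mul_one] at this
    simp only [Pi.smul_apply, Pi.sub_apply, Pi.add_apply, smul_eq_mul, Sum.elim_inr]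
    refine this.trans ?_
    congr 5 <;> simp <;> ring
  have haff (i) : affineFun (a i) (b i) ∈ affineOutputs g := by
    have := add_mem (sum_mem fun j (_ : j ∈ Finset.univ) =>
      (affineOutputs g).smul_mem (a i j) (hx j)) (const_mem_affineOutputs g (b i))
    convert this using 1
    funext x
    simp [affineFun]
  obtain ⟨k', g', hg', h'⟩ := hg.exists_prod_layers (ι := Fin d → Fin (N + 1)) (Nat.clog 2 d + 1)
    (fun i j => if hj : j < d then fun x => bump (N * x ⟨j, hj⟩ - (i ⟨j, hj⟩ : ℕ))
      else if j = d then affineFun (a i) (b i) else 1)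
    (fun i j => by
      split_ifs with h₁ h₂
      · exact hbump _ _
      · exact haff i
      · exact const_mem_affineOutputs g 1)
    (by simpa using hW₂)
  have hdpow : d + 1 ≤ 2 ^ (Nat.clog 2 d + 1) := by
    have := Nat.le_pow_clog one_lt_two d
    rw [pow_succ]
    omega
  have hglue : glue a b ∈ affineOutputs g' := by
    convert sum_mem fun i (_ : i ∈ Finset.univ) => h' i using 1
    funext x
    rw [Finset.sum_apply, glue]
    refine Finset.sum_congr rfl fun i _ => ?_
    rw [← Finset.prod_subset (Finset.range_subset_range.2 hdpow) fun j _ hj => by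
      rw [Finset.mem_range] at hj
      rw [dif_neg (by omega), if_neg (by omega)], Finset.prod_range_succ, Pi.mul_apply,
      dif_neg (lt_irrefl d), if_pos rfl, Finset.prod_range, Finset.prod_apply, tensorBump]
    simp
  have := hg'.isNetwork hglue
  convert this using 1
  omega

lemma H1normSq_nonneg (d : ℕ) (u : EuclideanSpace ℝ (Fin d) → ℝ) : 0 ≤ H1normSq d u :=
  add_nonneg (integral_nonneg fun _ => sq_nonneg _) (integral_nonneg fun _ => sq_nonneg _)

lemma H2normSq_eq (d : ℕ) (u : EuclideanSpace ℝ (Fin d) → ℝ) :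
    H2normSq d u = H1normSq d u + ∫ x in openCube d, hessianSq u x := rfl

lemma isNetwork_zero (acts : Set (ℝ → ℝ)) (m W : ℕ) : IsNetwork acts m 1 W 0 :=
  ⟨m, _, 0, 0, NNHidden.base, fun x => by simp⟩

lemma network_width_le {d N n : ℕ} (hd : 1 < d) (hn : 4 * (N + 1) ≤ n) :
    d * ((N + 2) * 3) + d * 4 ≤ 4 * d * n ^ d ∧
      4 * ((N + 1) ^ d * 2 ^ (Nat.clog 2 d + 1)) ≤ 4 * d * n ^ d := by
  constructor
  · have h : n ≤ n ^ d := Nat.le_self_pow (by omega) n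
    calc d * ((N + 2) * 3) + d * 4 = d * (3 * N + 10) := by ring
      _ ≤ d * (4 * n) := Nat.mul_le_mul_left d (by omega)
      _ ≤ d * (4 * n ^ d) := by gcongr
      _ = 4 * d * n ^ d := by ring
  · have h₁ : 2 ^ (Nat.clog 2 d - 1) < d := Nat.pow_pred_clog_lt_self one_lt_two hd
    have h₂ : 0 < Nat.clog 2 d := Nat.clog_pos one_lt_two hd
    have h₃ : 2 ^ (Nat.clog 2 d + 1) ≤ 4 * d := by
      obtain ⟨c, hc⟩ : ∃ c, Nat.clog 2 d = c + 1 := ⟨_, (Nat.succ_pred h₂.ne').symm⟩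
      rw [hc, Nat.add_sub_cancel] at h₁
      rw [hc, pow_succ, pow_succ]
      omega
    calc 4 * ((N + 1) ^ d * 2 ^ (Nat.clog 2 d + 1)) ≤ 4 * ((N + 1) ^ d * (4 * d)) := by gcongr
      _ = 4 * d * (4 * (N + 1) ^ d) := by ring
      _ ≤ 4 * d * (4 ^ d * (N + 1) ^ d) := by
          gcongr
          exact Nat.le_self_pow (by omega) 4
      _ = 4 * d * (4 * (N + 1)) ^ d := by rw [mul_pow]
      _ ≤ 4 * d * n ^ d := by gcongr

/-- **Approximation error of deep `ReLU²` networks in `H¹` norm (Theorem 3.2).**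
For every `d > 1` there is a constant `C > 0` depending only on `d` such that
every `u*` that is `C²` on a neighborhood of `[0,1]^d` with `‖u*‖_{H²} ≤ c₂`
admits a `ReLU²` network approximation `ū` of depth at most `⌈log₂ d⌉ + 3` and
width at most `4d·⌈C·c₂/ε − 4⌉^d` with `‖u* − ū‖_{H¹} ≤ ε`. -/
theorem relu2_network_H1_approximation (d : ℕ) (hd : 1 < d) :
    ∃ C > (0:ℝ), ∀ c₂ : ℝ, 0 < c₂ → ∀ ε : ℝ, 0 < ε →
      ∀ ustar : EuclideanSpace ℝ (Fin d) → ℝ,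
        (∃ U, IsOpen U ∧ closedCube d ⊆ U ∧ ContDiffOn ℝ 2 ustar U) →
        Real.sqrt (H2normSq d ustar) ≤ c₂ →
        ∃ (D : ℕ) (ubar : EuclideanSpace ℝ (Fin d) → ℝ),
          D ≤ Nat.clog 2 d + 3 ∧
          IsNetwork {relu2} d D (4 * d * (⌈C * c₂ / ε - 4⌉₊)^d) ubar ∧
          Real.sqrt (H1normSq d (ustar - ubar)) ≤ ε := by
  have hκ : 0 ≤ glueConst d := by unfold glueConst; positivity
  set κ : ℝ := √(glueConst d) with hκ_def
  have hκ₀ : 0 ≤ κ := Real.sqrt_nonneg _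
  refine ⟨4 * κ + 16, by positivity, fun c₂ hc₂ ε hε u hu hc => ?_⟩
  obtain ⟨U, hU, hQU, hu⟩ := hu
  rcases le_or_gt c₂ ε with hεc | hεc
  · refine ⟨1, 0, by omega, isNetwork_zero _ _ _, ?_⟩
    rw [sub_zero]
    refine (Real.sqrt_le_sqrt ?_).trans (hc.trans hεc)
    exact le_add_of_nonneg_right (integral_nonneg (hessianSq_nonneg u))
  have hr : 1 < c₂ / ε := (one_lt_div hε).2 hεc
  set N : ℕ := ⌈κ * (c₂ / ε)⌉₊ + 1 with hN_def
  have hN : 0 < N := Nat.succ_pos _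
  have hN' : (0 : ℝ) < N := by exact_mod_cast hN
  have hNge : κ * (c₂ / ε) ≤ N := by
    rw [hN_def]
    push_cast
    linarith [Nat.le_ceil (κ * (c₂ / ε))]
  have hNle : (N : ℝ) ≤ κ * (c₂ / ε) + 2 := by
    rw [hN_def]
    push_cast
    linarith [Nat.ceil_lt_add_one (show 0 ≤ κ * (c₂ / ε) by positivity)]
  have hn : 4 * (N + 1) ≤ ⌈(4 * κ + 16) * c₂ / ε - 4⌉₊ := by
    rw [mul_div_assoc, ← Nat.cast_le (α := ℝ)]
    refine le_trans ?_ (Nat.le_ceil _)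
    push_cast
    linarith
  obtain ⟨hW₁, hW₂⟩ := network_width_le hd hn
  obtain ⟨a, b, hab⟩ := exists_H1normSq_sub_glue_le hN hU hQU hu
  refine ⟨_, glue a b, le_rfl, isNetwork_glue hd a b hW₁ hW₂, ?_⟩
  have hH : ∫ x in openCube d, hessianSq u x ≤ c₂ ^ 2 := by
    have h := (Real.sqrt_le_left hc₂.le).1 hc
    rw [H2normSq_eq] at h
    linarith [H1normSq_nonneg d u]
  refine Real.sqrt_le_iff.2 ⟨hε.le, hab.trans ?_⟩
  calc glueConst d / (N : ℝ) ^ 2 * ∫ x in openCube d, hessianSq u x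
      ≤ glueConst d / (N : ℝ) ^ 2 * c₂ ^ 2 := by gcongr
    _ = (κ * c₂ / N) ^ 2 := by
        rw [div_pow, mul_pow, hκ_def, Real.sq_sqrt hκ]
        ring
    _ ≤ ε ^ 2 := by
        refine pow_le_pow_left₀ (by positivity) ?_ 2
        rw [div_le_iff₀ hN', mul_comm ε, ← div_le_iff₀ hε, mul_div_assoc]
        exact hNge
end
end

section
/- Let B > 0 and let F be a countable class of functions from a set X to [0, B] containing the zero function, with pseudo-dimension p = Pdim(F) satisfying 1 ≤ p < ∞. Let (X, μ) be a probability space on which the functions in F are measurable, let n ≥ p, let Z₁,…,Z_n be i.i.d. with law μ, and let σ₁,…,σ_n be i.i.d. Rademacher variables (uniform on {−1,1}) independent of (Z₁,…,Z_n). Then E[ sup_{f∈F} (1/n)|Σ_{i=1}^n σᵢ f(Zᵢ)| ] ≤ 28·√(3/2)·B·√(p/n)·√(log(e·n/p)). -/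
open MeasureTheory

/-- `F` pseudo-shatters the finite set `s`: there are witnesses `y x` such that
every sign pattern `b` on `s` is realized by some `f ∈ F` via `f x > y x ↔ b x`. -/
def PseudoShatters {X : Type*} (F : Set (X → ℝ)) (s : Finset X) : Prop :=
  ∃ y : X → ℝ, ∀ b : X → Bool, ∃ f ∈ F, ∀ x ∈ s, (y x < f x ↔ b x = true)

open Finset in
/-- The traces of strict superlevel sets shatter `S` only if `F` pseudo-shatters a set of the same
cardinality. -/
theorem exists_pseudoShatters_of_shatters {X ι : Type*} [DecidableEq ι] {F : Set (X → ℝ)}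
    (φ : ι → X) (y : ι → ℝ) {𝒜 : Finset (Finset ι)}
    (h𝒜 : ∀ u ∈ 𝒜, ∃ f ∈ F, ∀ q, q ∈ u ↔ y q < f (φ q))
    {S : Finset ι} (hS : 𝒜.Shatters S) :
    ∃ s : Finset X, PseudoShatters F s ∧ s.card = S.card := by
  classical
  have key : ∀ q ∈ S, ∀ q' ∈ S, φ q = φ q' → y q ≤ y q' → q = q' := by
    intro q hq q' hq' hφ hy
    obtain ⟨u, hu, hSu⟩ := hS (singleton_subset_iff.2 hq')
    obtain ⟨f, -, hf⟩ := h𝒜 u hu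
    have h' : q' ∈ u := (mem_inter.1 (hSu ▸ mem_singleton_self q')).2
    have hqu : q ∈ u := (hf q).2 (hy.trans_lt (hφ ▸ (hf q').1 h'))
    exact mem_singleton.1 (hSu ▸ mem_inter.2 ⟨hq, hqu⟩)
  have hinj : Set.InjOn φ S := by
    intro q hq q' hq' hφ
    rcases le_total (y q) (y q') with h | h
    · exact key q hq q' hq' hφ h
    · exact (key q' hq' q hq hφ.symm h).symm
  have hc : ∀ x, ∃ c, ∀ q ∈ S, φ q = x → y q = c := by
    intro x
    by_cases hx : ∃ q ∈ S, φ q = x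
    · obtain ⟨q, hq, rfl⟩ := hx
      exact ⟨y q, fun q' hq' h => by rw [hinj hq' hq h]⟩
    · exact ⟨0, fun q hq h => (hx ⟨q, hq, h⟩).elim⟩
  choose c hc using hc
  refine ⟨S.image φ, ⟨c, fun b => ?_⟩, card_image_of_injOn hinj⟩
  obtain ⟨u, hu, hSu⟩ := hS (filter_subset (fun q => b (φ q) = true) S)
  obtain ⟨f, hfF, hf⟩ := h𝒜 u hu
  refine ⟨f, hfF, fun x hx => ?_⟩
  obtain ⟨q, hq, rfl⟩ := mem_image.1 hx
  rw [← hc _ q hq rfl, ← hf q]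
  have := congrArg (q ∈ ·) hSu
  simpa [hq] using this

/-- The partial sums of binomial coefficients satisfy `∑_{i ≤ p} C(m, i) ≤ (e m / p) ^ p`. -/
theorem sum_choose_le_exp_mul_div_pow {m p : ℕ} (hp : 1 ≤ p) (hpm : p ≤ m) :
    ((∑ i ∈ Finset.Iic p, m.choose i : ℕ) : ℝ) ≤ (Real.exp 1 * m / p) ^ p := by
  have hp0 : (0 : ℝ) < p := by exact_mod_cast hp
  have hm0 : (0 : ℝ) < m := by exact_mod_cast hp.trans hpm
  set r : ℝ := p / m with hr
  have hr0 : 0 < r := by positivity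
  have hr1 : r ≤ 1 := (div_le_one hm0).2 (by exact_mod_cast hpm)
  have h1 : r ^ p * ((∑ i ∈ Finset.Iic p, m.choose i : ℕ) : ℝ) ≤ (r + 1) ^ m := by
    rw [add_pow]
    push_cast
    rw [Finset.mul_sum]
    calc ∑ i ∈ Finset.Iic p, r ^ p * (m.choose i : ℝ)
        ≤ ∑ i ∈ Finset.Iic p, r ^ i * 1 ^ (m - i) * (m.choose i : ℝ) := by
          refine Finset.sum_le_sum fun i hi => ?_
          rw [one_pow, mul_one]
          exact mul_le_mul_of_nonneg_right
            (pow_le_pow_of_le_one hr0.le hr1 (Finset.mem_Iic.1 hi)) (Nat.cast_nonneg _)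
      _ ≤ _ := by
          refine Finset.sum_le_sum_of_subset_of_nonneg (fun i hi => ?_) fun i _ _ => by positivity
          have := Finset.mem_Iic.1 hi
          exact Finset.mem_range.2 (by omega)
  have h2 : (r + 1) ^ m ≤ Real.exp 1 ^ p := by
    calc (r + 1) ^ m ≤ Real.exp r ^ m := by gcongr; exact Real.add_one_le_exp r
      _ = Real.exp 1 ^ p := by
          rw [← Real.exp_nat_mul, ← Real.exp_nat_mul, hr]
          congr 1
          field_simp
  have h3 : Real.exp 1 * m / p = Real.exp 1 / r := by rw [hr]; field_simp
  rw [h3, div_pow, le_div_iff₀ (pow_pos hr0 p), mul_comm]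
  exact h1.trans h2

/-- If no grid point `B * j / k` separates `a` from `b`, then `a` exceeds `b` by at most `B / k`. -/
theorem le_add_div_of_grid {B a b : ℝ} (hB : 0 < B) {k : ℕ} (hk : 0 < k) (haB : a ≤ B)
    (hb : 0 ≤ b) (h : ∀ j : Fin k, B * (j : ℕ) / k < a → B * (j : ℕ) / k < b) :
    a ≤ b + B / k := by
  by_contra! hab
  have hk0 : (0 : ℝ) < k := by exact_mod_cast hk
  set j : ℕ := ⌈k * b / B⌉₊
  have hj1 : b ≤ B * j / k := by
    have := Nat.le_ceil (k * b / B)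
    rw [div_le_iff₀ hB] at this
    rw [le_div_iff₀ hk0]
    linarith
  have hj2 : B * j / k < a := by
    have := Nat.ceil_lt_add_one (a := k * b / B) (by positivity)
    refine lt_trans ?_ hab
    rw [show b + B / k = B * (k * b / B + 1) / k by field_simp]
    gcongr
  have hjk : j < k := by
    have h1 : B * j < B * k := (div_lt_iff₀ hk0).1 (hj2.trans_le haB)
    exact_mod_cast lt_of_mul_lt_mul_left h1 hB.le
  exact (h ⟨j, hjk⟩ hj2).not_ge hj1

/-- The exponential moment of a Rademacher sum with coefficients bounded by `B`. -/
theorem sum_exp_rademacher_le {n : ℕ} {B : ℝ} (a : Fin n → ℝ) (ha : ∀ i, |a i| ≤ B) (l : ℝ) :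
    (1 / 2 ^ n : ℝ) * ∑ s : Fin n → Bool,
      Real.exp (l * ∑ i, (if s i then (1 : ℝ) else -1) * a i) ≤
      Real.exp (l ^ 2 * n * B ^ 2 / 2) := by
  have h1 : ∑ s : Fin n → Bool, Real.exp (l * ∑ i, (if s i then (1 : ℝ) else -1) * a i) =
      ∏ i, (2 * Real.cosh (l * a i)) := by
    calc _ = ∑ s : Fin n → Bool, ∏ i, Real.exp (l * ((if s i then (1 : ℝ) else -1) * a i)) := by
          simp_rw [Finset.mul_sum, Real.exp_sum]
      _ = ∏ i, ∑ b : Bool, Real.exp (l * ((if b then (1 : ℝ) else -1) * a i)) := by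
          rw [Finset.prod_univ_sum, Fintype.piFinset_univ]
      _ = _ := by
          refine Finset.prod_congr rfl fun i _ => ?_
          rw [Fintype.sum_bool, Real.cosh_eq]
          simp
          ring
  rw [h1, Finset.prod_mul_distrib, Finset.prod_const, Finset.card_univ, Fintype.card_fin,
    ← mul_assoc, one_div_mul_cancel (by positivity), one_mul]
  calc ∏ i, Real.cosh (l * a i) ≤ ∏ _i : Fin n, Real.exp (l ^ 2 * B ^ 2 / 2) := by
        refine Finset.prod_le_prod (fun i _ => (Real.cosh_pos _).le) fun i _ => ?_
        refine (Real.cosh_le_exp_half_sq _).trans (Real.exp_le_exp.2 ?_)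
        have := sq_le_sq' (neg_le_of_abs_le (ha i)) (le_of_abs_le (ha i))
        rw [mul_pow]
        gcongr
    _ = _ := by
        rw [Finset.prod_const, Finset.card_univ, Fintype.card_fin, ← Real.exp_nat_mul]
        congr 1
        ring

/-- A uniform covering bound on a sample: a class of functions into `[0, B]` of pseudo-dimension at
most `p` has a `B / k`-net on `n` points of cardinality at most `(e n k / p) ^ p`. -/
theorem exists_finset_cover_of_pdim {X : Type*} {B : ℝ} (hB : 0 < B) {F : Set (X → ℝ)}
    (hrange : ∀ f ∈ F, ∀ x, f x ∈ Set.Icc (0 : ℝ) B) {p : ℕ} (hp : 1 ≤ p)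
    (hpdim : ∀ s : Finset X, PseudoShatters F s → s.card ≤ p)
    {n k : ℕ} (hnp : p ≤ n) (hk : 0 < k) (z : Fin n → X) :
    ∃ G : Finset (X → ℝ), ↑G ⊆ F ∧
      (G.card : ℝ) ≤ (Real.exp 1 * (n * k : ℕ) / p) ^ p ∧
      ∀ f ∈ F, ∃ g ∈ G, ∀ i, |f (z i) - g (z i)| ≤ B / k := by
  classical
  let y : Fin n × Fin k → ℝ := fun q => B * (q.2 : ℕ) / k
  let tr : (X → ℝ) → Finset (Fin n × Fin k) :=
    fun f => Finset.univ.filter fun q => y q < f (z q.1)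
  let 𝒜 : Finset (Finset (Fin n × Fin k)) := Finset.univ.filter fun u => ∃ f ∈ F, tr f = u
  have h𝒜 : ∀ u ∈ 𝒜, ∃ f ∈ F, tr f = u := fun u hu => (Finset.mem_filter.1 hu).2
  have hvc : 𝒜.vcDim ≤ p := by
    refine Finset.sup_le fun S hS => ?_
    obtain ⟨s, hs, hcard⟩ := exists_pseudoShatters_of_shatters (F := F) (fun q => z q.1) y
      (fun u hu => by
        obtain ⟨f, hf, rfl⟩ := h𝒜 u hu
        exact ⟨f, hf, fun q => by simp [tr]⟩) (Finset.mem_shatterer.1 hS)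
    exact hcard ▸ hpdim s hs
  have hcard : (𝒜.card : ℝ) ≤ (Real.exp 1 * (n * k : ℕ) / p) ^ p := by
    refine le_trans ?_ (sum_choose_le_exp_mul_div_pow hp (hnp.trans (Nat.le_mul_of_pos_right n hk)))
    have h := 𝒜.card_le_card_shatterer.trans Finset.card_shatterer_le_sum_vcDim
    rw [Fintype.card_prod, Fintype.card_fin, Fintype.card_fin] at h
    exact_mod_cast h.trans (Finset.sum_le_sum_of_subset (Finset.Iic_subset_Iic.2 hvc))
  choose! r hrF hr using h𝒜
  refine ⟨𝒜.image r, ?_, ?_, fun f hf => ?_⟩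
  · intro g hg
    obtain ⟨u, hu, rfl⟩ := Finset.mem_image.1 hg
    exact hrF u hu
  · exact (Nat.cast_le.2 Finset.card_image_le).trans hcard
  · have hu : tr f ∈ 𝒜 := Finset.mem_filter.2 ⟨Finset.mem_univ _, f, hf, rfl⟩
    refine ⟨r (tr f), Finset.mem_image_of_mem r hu, fun i => ?_⟩
    have hiff : ∀ j : Fin k, B * (j : ℕ) / k < r (tr f) (z i) ↔ B * (j : ℕ) / k < f (z i) := by
      intro j
      have := congrArg ((i, j) ∈ ·) (hr _ hu)
      simpa [tr, y] using this
    obtain ⟨hf0, hfB⟩ := hrange f hf (z i)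
    obtain ⟨hg0, hgB⟩ := hrange _ (hrF _ hu) (z i)
    have h1 := le_add_div_of_grid hB hk hfB hg0 fun j => (hiff j).2
    have h2 := le_add_div_of_grid hB hk hgB hf0 fun j => (hiff j).1
    rw [abs_le]
    constructor <;> linarith

/-- A Massart-type bound: if `G` is an `ε`-net of `F` on the sample `z` and `c` dominates the
logarithm of the exponential moments, then the empirical Rademacher average of `F` is controlled. -/
theorem rademacher_average_le_of_cover {X : Type*} {B : ℝ} {F : Set (X → ℝ)} (hF : F.Nonempty)
    {n : ℕ} (hn : 0 < n) (z : Fin n → X) {ε : ℝ} (G : Finset (X → ℝ))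
    (hGB : ∀ g ∈ G, ∀ i, |g (z i)| ≤ B)
    (hcover : ∀ f ∈ F, ∃ g ∈ G, ∀ i, |f (z i) - g (z i)| ≤ ε)
    {l c : ℝ} (hl : 0 < l)
    (hc : 2 * G.card * Real.exp (l ^ 2 * n * B ^ 2 / 2) ≤ Real.exp c) :
    (1 / 2 ^ n : ℝ) * ∑ s : Fin n → Bool,
        sSup ((fun f : X → ℝ =>
          (1 / n : ℝ) * |∑ i, (if s i then (1:ℝ) else -1) * f (z i)|) '' F)
      ≤ ε + c / (l * n) := by
  have hn0 : (0 : ℝ) < n := by exact_mod_cast hn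
  let R : (Fin n → Bool) → (X → ℝ) → ℝ := fun s g => ∑ i, (if s i then (1:ℝ) else -1) * g (z i)
  let E : (Fin n → Bool) → ℝ := fun s =>
    ∑ g ∈ G, (Real.exp (l * R s g) + Real.exp (-l * R s g))
  have hsup : ∀ s, sSup ((fun f : X → ℝ => (1 / n : ℝ) * |R s f|) '' F) ≤
      ε + (c - 1 + Real.exp (-c) * E s) / (l * n) := by
    intro s
    refine csSup_le (hF.image _) ?_
    rintro _ ⟨f, hf, rfl⟩
    obtain ⟨g, hg, hfg⟩ := hcover f hf
    have h1 : |R s f| ≤ n * ε + |R s g| := by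
      have h2 : |R s f - R s g| ≤ n * ε := by
        calc |R s f - R s g| = |∑ i, (if s i then (1:ℝ) else -1) * (f (z i) - g (z i))| := by
              simp only [R, mul_sub, Finset.sum_sub_distrib]
          _ ≤ ∑ i, |(if s i then (1:ℝ) else -1) * (f (z i) - g (z i))| :=
              Finset.abs_sum_le_sum_abs _ _
          _ ≤ ∑ _i : Fin n, ε := by
              refine Finset.sum_le_sum fun i _ => ?_
              rw [abs_mul]
              refine le_trans (le_of_eq ?_) (hfg i)
              split_ifs <;> simp
          _ = n * ε := by simp
      have := abs_sub_abs_le_abs_sub (R s f) (R s g)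
      linarith
    have h3 : Real.exp (l * |R s g|) ≤ E s := by
      refine le_trans ?_ (Finset.single_le_sum
        (f := fun g => Real.exp (l * R s g) + Real.exp (-l * R s g))
        (fun g _ => by positivity) hg)
      rcases abs_cases (R s g) with ⟨h, -⟩ | ⟨h, -⟩
      · rw [h]
        linarith [Real.exp_pos (-l * R s g)]
      · rw [h, mul_neg, ← neg_mul]
        linarith [Real.exp_pos (l * R s g)]
    have h4 : l * |R s g| ≤ c - 1 + Real.exp (-c) * E s := by
      have h5 := Real.add_one_le_exp (l * |R s g| - c)
      have h6 : Real.exp (l * |R s g| - c) ≤ Real.exp (-c) * E s := by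
        rw [sub_eq_neg_add, Real.exp_add]
        gcongr
      linarith
    have h7 : |R s g| ≤ (c - 1 + Real.exp (-c) * E s) / l := by
      rw [le_div_iff₀ hl]
      linarith
    calc (1 / n : ℝ) * |R s f| ≤ (1 / n) * (n * ε + (c - 1 + Real.exp (-c) * E s) / l) := by
          gcongr
          exact h1.trans (by linarith)
      _ = _ := by field_simp
  have hE : (1 / 2 ^ n : ℝ) * ∑ s, E s ≤ Real.exp c := by
    refine le_trans ?_ hc
    calc (1 / 2 ^ n : ℝ) * ∑ s, E s
        = ∑ g ∈ G, ((1 / 2 ^ n : ℝ) * ∑ s, Real.exp (l * R s g) +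
            (1 / 2 ^ n : ℝ) * ∑ s, Real.exp (-l * R s g)) := by
          simp only [E]
          rw [Finset.sum_comm, Finset.mul_sum]
          refine Finset.sum_congr rfl fun g _ => ?_
          rw [Finset.sum_add_distrib, mul_add]
      _ ≤ ∑ g ∈ G, 2 * Real.exp (l ^ 2 * n * B ^ 2 / 2) := by
          refine Finset.sum_le_sum fun g hg => ?_
          have h1 := sum_exp_rademacher_le (fun i => g (z i)) (hGB g hg) l
          have h2 := sum_exp_rademacher_le (fun i => g (z i)) (hGB g hg) (-l)
          rw [neg_sq] at h2
          linarith
      _ = _ := by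
          rw [Finset.sum_const, nsmul_eq_mul]
          ring
  calc _ ≤ (1 / 2 ^ n : ℝ) * ∑ s : Fin n → Bool,
        (ε + (c - 1 + Real.exp (-c) * E s) / (l * n)) := by
        gcongr with s
        exact hsup s
    _ = ε + (c - 1 + Real.exp (-c) * ((1 / 2 ^ n : ℝ) * ∑ s, E s)) / (l * n) := by
        rw [Finset.sum_add_distrib, ← Finset.sum_div, Finset.sum_add_distrib, ← Finset.mul_sum]
        simp only [Finset.sum_const, Finset.card_univ, Fintype.card_fun, Fintype.card_fin,
          Fintype.card_bool, nsmul_eq_mul]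
        push_cast
        field_simp
    _ ≤ ε + c / (l * n) := by
        have : Real.exp (-c) * ((1 / 2 ^ n : ℝ) * ∑ s, E s) ≤ 1 := by
          calc _ ≤ Real.exp (-c) * Real.exp c := by gcongr
            _ = 1 := by rw [← Real.exp_add, neg_add_cancel, Real.exp_zero]
        gcongr
        linarith

/-- **Rademacher complexity bound via pseudo-dimension (equation (3.14)).**
For a countable class `F` of measurable functions `X → [0,B]` containing `0`
with pseudo-dimension `p`, `1 ≤ p ≤ n`,
`E[sup_{f∈F} (1/n)|Σᵢ σᵢ f(Zᵢ)|] ≤ 28·√(3/2)·B·√(p/n)·√(log(e·n/p))`.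
The i.i.d. sample `Z₁,…,Z_n ∼ μ` is modelled by the product measure, and the
expectation over the independent Rademacher signs is written as the average
over all sign patterns `s : Fin n → Bool`. -/
theorem rademacher_bound_of_pdim {X : Type*} [MeasurableSpace X] (μ : Measure X)
    [IsProbabilityMeasure μ] (B : ℝ) (hB : 0 < B)
    (F : Set (X → ℝ)) (hFc : F.Countable) (h0 : (fun _ => (0:ℝ)) ∈ F)
    (hmeas : ∀ f ∈ F, Measurable f)
    (hrange : ∀ f ∈ F, ∀ x, f x ∈ Set.Icc (0:ℝ) B)
    (p : ℕ) (hp : 1 ≤ p)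
    (hpdim_ub : ∀ s : Finset X, PseudoShatters F s → s.card ≤ p)
    (hpdim_lb : ∃ s : Finset X, PseudoShatters F s ∧ s.card = p)
    (n : ℕ) (hnp : p ≤ n) :
    (∫ z : Fin n → X, ((1 / 2 ^ n : ℝ) * ∑ s : Fin n → Bool,
        sSup ((fun f : X → ℝ =>
          (1 / n : ℝ) * |∑ i, (if s i then (1:ℝ) else -1) * f (z i)|) '' F))
      ∂(Measure.pi fun _ => μ))
      ≤ 28 * Real.sqrt (3/2) * B * Real.sqrt ((p : ℝ) / n) *
          Real.sqrt (Real.log (Real.exp 1 * n / p)) := by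
  have hp0 : (0 : ℝ) < p := by exact_mod_cast hp
  have hn : 0 < n := hp.trans hnp
  have hn0 : (0 : ℝ) < n := by exact_mod_cast hn
  have hpn : (p : ℝ) ≤ n := by exact_mod_cast hnp
  set L : ℝ := Real.log (Real.exp 1 * n / p) with hL
  have hexpL : Real.exp L = Real.exp 1 * n / p := Real.exp_log (by positivity)
  have hL1 : 1 ≤ L := by
    rw [← Real.exp_le_exp, hexpL, le_div_iff₀ hp0]
    gcongr
  set r : ℝ := Real.sqrt ((p : ℝ) / n) * Real.sqrt L with hr
  have hr0 : 0 < r := by positivity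
  have hr2 : r ^ 2 * n = p * L := by
    rw [hr, mul_pow, Real.sq_sqrt (by positivity), Real.sq_sqrt (by positivity)]
    field_simp
  obtain ⟨k, hk, hk1, hk2⟩ : ∃ k : ℕ, 0 < k ∧ (n : ℝ) / p ≤ k ∧ (k : ℝ) ≤ 2 * (n / p) := by
    have h1 : 1 ≤ (n : ℝ) / p := (one_le_div hp0).2 hpn
    refine ⟨⌈(n : ℝ) / p⌉₊, Nat.ceil_pos.2 (by positivity), Nat.le_ceil _, ?_⟩
    linarith [Nat.ceil_lt_add_one (a := (n : ℝ) / p) (by positivity)]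
  have hk0 : (0 : ℝ) < k := by exact_mod_cast hk
  have hkr : B / k ≤ B * r := by
    rw [div_eq_mul_inv]
    gcongr
    have h1 : (k : ℝ)⁻¹ ≤ p / n := by
      rw [← inv_div]
      gcongr
    have h2 : (p : ℝ) / n ≤ 1 := (div_le_one hn0).2 hpn
    have h3 : (p : ℝ) / n ≤ Real.sqrt (p / n) := Real.le_sqrt_of_sq_le (by nlinarith [div_pos hp0 hn0])
    have h4 : 1 ≤ Real.sqrt L := Real.one_le_sqrt.2 hL1
    calc (k : ℝ)⁻¹ ≤ Real.sqrt (p / n) * 1 := by linarith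
      _ ≤ r := by rw [hr]; gcongr
  have hnet : (Real.exp 1 * (n * k : ℕ) / p) ^ p ≤ Real.exp (2 * (p * L)) := by
    rw [show 2 * ((p : ℝ) * L) = p * (L + L) by ring, Real.exp_nat_mul, Real.exp_add, hexpL]
    gcongr
    push_cast
    have : (k : ℝ) ≤ Real.exp 1 * (n / p) :=
      hk2.trans (by gcongr; linarith [Real.add_one_le_exp (1 : ℝ)])
    calc Real.exp 1 * (n * k) / p = Real.exp 1 * n / p * k := by ring
      _ ≤ Real.exp 1 * n / p * (Real.exp 1 * (n / p)) := by gcongr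
      _ = _ := by ring
  have hpL : 1 ≤ (p : ℝ) * L := one_le_mul_of_one_le_of_one_le (by exact_mod_cast hp) hL1
  have hbound : ∀ z : Fin n → X, (1 / 2 ^ n : ℝ) * ∑ s : Fin n → Bool,
        sSup ((fun f : X → ℝ =>
          (1 / n : ℝ) * |∑ i, (if s i then (1:ℝ) else -1) * f (z i)|) '' F) ≤ 5 * (B * r) := by
    intro z
    obtain ⟨G, hGF, hGcard, hG⟩ :=
      exists_finset_cover_of_pdim hB hrange hp hpdim_ub hnp hk z
    have hGB : ∀ g ∈ G, ∀ i, |g (z i)| ≤ B := fun g hg i => by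
      obtain ⟨h1, h2⟩ := hrange g (hGF hg) (z i)
      rwa [abs_of_nonneg h1]
    refine (rademacher_average_le_of_cover ⟨_, h0⟩ hn z G hGB hG (l := r / B)
      (c := 4 * (p * L)) (by positivity) ?_).trans ?_
    · have h1 : (r / B) ^ 2 * n * B ^ 2 / 2 = p * L / 2 := by
        rw [← hr2]
        field_simp
      rw [h1]
      have h2 : (2 : ℝ) ≤ Real.exp (p * L) := by linarith [Real.add_one_le_exp ((p : ℝ) * L)]
      calc 2 * (G.card : ℝ) * Real.exp (p * L / 2)
          ≤ Real.exp (p * L) * Real.exp (2 * (p * L)) * Real.exp (p * L / 2) := by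
            gcongr
            exact hGcard.trans hnet
        _ ≤ Real.exp (4 * (p * L)) := by
            rw [← Real.exp_add, ← Real.exp_add, Real.exp_le_exp]
            linarith
    · have h1 : 4 * (p * L) / (r / B * n) = 4 * (B * r) := by
        rw [← hr2]
        field_simp
      rw [h1]
      linarith
  have hsqrt : 1 ≤ Real.sqrt (3 / 2) := Real.one_le_sqrt.2 (by norm_num)
  calc _ ≤ ∫ _z : Fin n → X, 5 * (B * r) ∂(Measure.pi fun _ => μ) := by
        refine integral_mono_of_nonneg (.of_forall fun z => ?_) (integrable_const _)
          (.of_forall hbound)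
        refine mul_nonneg (by positivity) (Finset.sum_nonneg fun s _ => Real.sSup_nonneg ?_)
        rintro _ ⟨f, -, rfl⟩
        positivity
    _ = 5 * (B * r) := by simp
    _ ≤ 28 * Real.sqrt (3 / 2) * (B * r) := by
        gcongr
        linarith
    _ = _ := by rw [hr]; ring
end
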